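/- arXiv:1803.05244 — 7 statements merged into one kernel-verified Lean document; each statement's English description precedes it below -/
import Mathlib

section
/- Under Axiom (T.0) and with u₀ strictly increasing, continuous, u₀(0)=0, the maps V₁⁻(f) = sup{u₀(a) : a ∈ ℝ, a ⪯ f} and V₁⁺(f) = inf{u₀(a) : a ∈ ℝ, a ⪰ f} are well defined as real numbers (both sets are nonempty and the sup/inf are finite) for every f ∈ 𝓛∞(F₁), and V₁⁺(f) = V₁⁻(f) for every f ∈ 𝓛∞(F₁). -/
open MeasureTheory Set

/-- Bounded `G`-measurable real-valued functions (the space `𝓛∞(G)`). -/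
def BddMeas {Ω : Type*} (G : MeasurableSpace Ω) (f : Ω → ℝ) : Prop :=
  Measurable[G] f ∧ ∃ C, ∀ ω, |f ω| ≤ C

/-- Under Axiom (T.0) and with `u₀` strictly increasing, continuous and `u₀ 0 = 0`,
the maps `V₁⁻ f = sup {u₀ a : a ⪯ f}` and `V₁⁺ f = inf {u₀ a : a ⪰ f}` are well defined
(real valued: both sets are nonempty and bounded appropriately) and coincide. -/
theorem V1_plus_eq_V1_minus
    {Ω : Type*} [F : MeasurableSpace Ω] (F₁ : MeasurableSpace Ω) (hF₁ : F₁ ≤ F)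
    (u₀ : ℝ → ℝ) (hu₀mono : StrictMono u₀) (hu₀cont : Continuous u₀) (hu₀zero : u₀ 0 = 0)
    (succ prec : ℝ → (Ω → ℝ) → Prop)
    -- Axiom (T.0): completeness
    (hcomplete : ∀ (a : ℝ) (f : Ω → ℝ), BddMeas F₁ f → succ a f ∨ prec a f)
    -- Axiom (T.0): transitivity
    (htrans : ∀ (a b : ℝ) (f : Ω → ℝ), BddMeas F₁ f → prec a f → succ b f → a ≤ b)
    -- Axiom (T.0): normalization
    (hnorm : succ 0 (fun _ => (0 : ℝ)) ∧ prec 0 (fun _ => (0 : ℝ)))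
    -- Axiom (T.0): non-degeneracy
    (hnondeg : ∀ f : Ω → ℝ, BddMeas F₁ f → (∃ y, prec y f) ∧ (∃ z, succ z f)) :
    ∀ f : Ω → ℝ, BddMeas F₁ f →
      (u₀ '' {a | prec a f}).Nonempty ∧ (u₀ '' {a | succ a f}).Nonempty ∧
      BddAbove (u₀ '' {a | prec a f}) ∧ BddBelow (u₀ '' {a | succ a f}) ∧
      sSup (u₀ '' {a | prec a f}) = sInf (u₀ '' {a | succ a f}) := by
  intro f hf
  obtain ⟨⟨y, hy⟩, ⟨z, hz⟩⟩ := hnondeg f hf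
  have hne1 : (u₀ '' {a | prec a f}).Nonempty := ⟨u₀ y, y, hy, rfl⟩
  have hne2 : (u₀ '' {a | succ a f}).Nonempty := ⟨u₀ z, z, hz, rfl⟩
  have hle : ∀ p ∈ u₀ '' {a | prec a f}, ∀ q ∈ u₀ '' {a | succ a f}, p ≤ q := by
    rintro _ ⟨a, ha, rfl⟩ _ ⟨b, hb, rfl⟩
    exact hu₀mono.monotone (htrans a b f hf ha hb)
  have hba : BddAbove (u₀ '' {a | prec a f}) :=
    ⟨u₀ z, fun p hp => hle p hp _ ⟨z, hz, rfl⟩⟩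
  have hbb : BddBelow (u₀ '' {a | succ a f}) :=
    ⟨u₀ y, fun q hq => hle _ ⟨y, hy, rfl⟩ q hq⟩
  refine ⟨hne1, hne2, hba, hbb, le_antisymm ?_ ?_⟩
  · exact csSup_le hne1 fun p hp => le_csInf hne2 fun q hq => hle p hp q hq
  · by_contra hlt
    obtain ⟨v, hv1, hv2⟩ := exists_between (not_le.mp hlt)
    have h1 : u₀ y ≤ v := (le_csSup hba ⟨y, hy, rfl⟩).trans hv1.le
    have h2 : v ≤ u₀ z := hv2.le.trans (csInf_le hbb ⟨z, hz, rfl⟩)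
    obtain ⟨c, rfl⟩ := mem_range_of_exists_le_of_exists_ge hu₀cont ⟨y, h1⟩ ⟨z, h2⟩
    rcases hcomplete c f hf with hc | hc
    · exact absurd (csInf_le hbb ⟨c, hc, rfl⟩) (not_le.mpr hv2)
    · exact absurd (le_csSup hba ⟨c, hc, rfl⟩) (not_le.mpr hv1)
end

section
/- Under Axiom (T.i) (with null events of G equal to subsets of P-null sets) and a state-dependent utility u_G with u_G(0,ω)=0 for all ω: for every f ∈ 𝓛∞(H) and A ∈ G, if g ∼ f then g·1_A ∼ f·1_A, and consequently the Conditional Certainty Equivalent satisfies C(f·1_A) = C(f)·1_A P-a.s.; equivalently, u_G(C(f·1_A)(·),·) = u_G(C(f)(·),·)·1_A P-a.s. -/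
open MeasureTheory Set

/-- Axiom (T.i) for a pair of relations `(⪰,⪯)` between `𝓛∞(G)` and `𝓛∞(H)`, where
an event of `G` is null iff it is `P`-null (i.e. contained in a `P`-null set). -/
structure AxiomT {Ω : Type*} (G H : MeasurableSpace Ω) (P : @MeasureTheory.Measure Ω G)
    (succ prec : (Ω → ℝ) → (Ω → ℝ) → Prop) : Prop where
  /-- local completeness -/
  locComplete : ∀ g f : Ω → ℝ, BddMeas G g → BddMeas H f →
    ∃ A : Set Ω, MeasurableSet[G] A ∧ P A ≠ 0 ∧
      (succ (A.indicator g) (A.indicator f) ∨ prec (A.indicator g) (A.indicator f))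
  /-- transitivity -/
  transit : ∀ g h f : Ω → ℝ, BddMeas G g → BddMeas G h → BddMeas H f →
    succ g f → prec h f → P {ω | g ω < h ω} = 0
  /-- normalization -/
  normal : ∀ A B : Set Ω, MeasurableSet[G] A → MeasurableSet[H] B →
    P A = 0 → P B = 0 →
      succ (A.indicator fun _ => (1 : ℝ)) (B.indicator fun _ => (1 : ℝ)) ∧
      prec (A.indicator fun _ => (1 : ℝ)) (B.indicator fun _ => (1 : ℝ))
  /-- non-degeneracy -/
  nondeg : ∀ f : Ω → ℝ, BddMeas H f →
    ∃ g₁ g₂ : Ω → ℝ, BddMeas G g₁ ∧ BddMeas G g₂ ∧ prec g₁ f ∧ succ g₂ f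
  /-- consistency -/
  consistent : ∀ g f : Ω → ℝ, BddMeas G g → BddMeas H f →
    ∀ A B : Set Ω, MeasurableSet[G] A → MeasurableSet[G] B → B ⊆ A →
      (succ (A.indicator g) (A.indicator f) → succ (B.indicator g) (B.indicator f)) ∧
      (prec (A.indicator g) (A.indicator f) → prec (B.indicator g) (B.indicator f))
  /-- stability -/
  stable : ∀ g f : Ω → ℝ, BddMeas G g → BddMeas H f →
    ∀ A B : Set Ω, MeasurableSet[G] A → MeasurableSet[G] B →
      (succ (A.indicator g) (A.indicator f) → succ (B.indicator g) (B.indicator f) →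
        succ ((A ∪ B).indicator g) ((A ∪ B).indicator f)) ∧
      (prec (A.indicator g) (A.indicator f) → prec (B.indicator g) (B.indicator f) →
        prec ((A ∪ B).indicator g) ((A ∪ B).indicator f))

/-- `g ≻^B f`: `g·1_B ⪰ f·1_B` but `g·1_{B'} ∼ f·1_{B'}` for no non-null `B' ⊆ B`. -/
def SuccStrictOn {Ω : Type*} (G : MeasurableSpace Ω) (P : @MeasureTheory.Measure Ω G)
    (succ prec : (Ω → ℝ) → (Ω → ℝ) → Prop) (g f : Ω → ℝ) (B : Set Ω) : Prop :=
  succ (B.indicator g) (B.indicator f) ∧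
    ∀ B' : Set Ω, MeasurableSet[G] B' → B' ⊆ B → P B' ≠ 0 →
      ¬ (succ (B'.indicator g) (B'.indicator f) ∧ prec (B'.indicator g) (B'.indicator f))

/-- `g ≺^C f`: `g·1_C ⪯ f·1_C` but `g·1_{C'} ∼ f·1_{C'}` for no non-null `C' ⊆ C`. -/
def PrecStrictOn {Ω : Type*} (G : MeasurableSpace Ω) (P : @MeasureTheory.Measure Ω G)
    (succ prec : (Ω → ℝ) → (Ω → ℝ) → Prop) (g f : Ω → ℝ) (C : Set Ω) : Prop :=
  prec (C.indicator g) (C.indicator f) ∧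
    ∀ C' : Set Ω, MeasurableSet[G] C' → C' ⊆ C → P C' ≠ 0 →
      ¬ (succ (C'.indicator g) (C'.indicator f) ∧ prec (C'.indicator g) (C'.indicator f))

/-- `★`-continuity of a random field with respect to a probability `Q`. -/
def StarCont {Ω : Type*} (G : MeasurableSpace Ω) (Q : @MeasureTheory.Measure Ω G)
    (u : ℝ → Ω → ℝ) : Prop :=
  ∀ f : Ω → ℝ, BddMeas G f → Q {ω | ¬ ContinuousAt (fun x => u x ω) (f ω)} = 0

/-- A state-dependent utility on `(Ω,G,P)`: `G`-measurable and `P`-integrable in `ω` for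
every `x`, strictly increasing in `x` for every `ω`, and `★`-continuous w.r.t. `P`. -/
structure StateDepUtility {Ω : Type*} (G : MeasurableSpace Ω)
    (P : @MeasureTheory.Measure Ω G) (u : ℝ → Ω → ℝ) : Prop where
  meas : ∀ x : ℝ, Measurable[G] (fun ω => u x ω)
  integrable : ∀ x : ℝ, Integrable (fun ω => u x ω) P
  strictMono : ∀ ω, StrictMono (fun x => u x ω)
  starCont : StarCont G P u

/-- **Localization of the Conditional Certainty Equivalent**: under Axiom (T.i), for a
state-dependent utility `u_G` with `u_G(0,·) = 0`: if `g ∼ f` then `g·1_A ∼ f·1_A` for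
every `A ∈ G`, and consequently any conditional certainty equivalent `g'` of `f·1_A`
satisfies `g' = g·1_A` `P`-a.s., equivalently `u_G(g'(·),·) = u_G(g(·),·)·1_A` `P`-a.s. -/
theorem CCE_localizes
    {Ω : Type*} [F : MeasurableSpace Ω] (G H : MeasurableSpace Ω)
    (hGH : G ≤ H) (hHF : H ≤ F)
    (P : @MeasureTheory.Measure Ω G) (hP : IsProbabilityMeasure P)
    (succ prec : (Ω → ℝ) → (Ω → ℝ) → Prop)
    (hT : AxiomT G H P succ prec)
    (uG : ℝ → Ω → ℝ) (huG : StateDepUtility G P uG)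
    (huG0 : ∀ ω, uG 0 ω = 0)
    (f : Ω → ℝ) (hf : BddMeas H f)
    (A : Set Ω) (hA : MeasurableSet[G] A)
    (g : Ω → ℝ) (hg : BddMeas G g) (hsim : succ g f ∧ prec g f) :
    (succ (A.indicator g) (A.indicator f) ∧ prec (A.indicator g) (A.indicator f)) ∧
    ∀ g' : Ω → ℝ, BddMeas G g' →
      succ g' (A.indicator f) → prec g' (A.indicator f) →
        g' =ᵐ[P] A.indicator g ∧
        (fun ω => uG (g' ω) ω) =ᵐ[P] A.indicator (fun ω => uG (g ω) ω) := by
  have hAg : BddMeas G (A.indicator g) := by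
    obtain ⟨hm, C, hC⟩ := hg
    refine ⟨hm.indicator hA, C, fun ω => ?_⟩
    by_cases h : ω ∈ A
    · simpa [h] using hC ω
    · simpa [h] using (abs_nonneg _).trans (hC ω)
  have hAf : BddMeas H (A.indicator f) := by
    obtain ⟨hm, C, hC⟩ := hf
    refine ⟨hm.indicator (hGH A hA), C, fun ω => ?_⟩
    by_cases h : ω ∈ A
    · simpa [h] using hC ω
    · simpa [h] using (abs_nonneg _).trans (hC ω)
  have hc := hT.consistent g f hg hf Set.univ A (@MeasurableSet.univ Ω G) hA (Set.subset_univ A)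
  rw [Set.indicator_univ, Set.indicator_univ] at hc
  have h1 := hc.1 hsim.1
  have h2 := hc.2 hsim.2
  refine ⟨⟨h1, h2⟩, fun g' hg' hs hp => ?_⟩
  have n1 := hT.transit g' (A.indicator g) (A.indicator f) hg' hAg hAf hs h2
  have n2 := hT.transit (A.indicator g) g' (A.indicator f) hAg hg' hAf h1 hp
  have e : g' =ᵐ[P] A.indicator g := by
    have m1 : ∀ᵐ ω ∂P, ¬ (g' ω < A.indicator g ω) := by
      rw [ae_iff]; simpa only [not_not] using n1
    have m2 : ∀ᵐ ω ∂P, ¬ (A.indicator g ω < g' ω) := by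
      rw [ae_iff]; simpa only [not_not] using n2
    filter_upwards [m1, m2] with ω a b
    exact le_antisymm (not_lt.mp b) (not_lt.mp a)
  refine ⟨e, ?_⟩
  filter_upwards [e] with ω h
  rw [h]
  by_cases hω : ω ∈ A
  · simp [hω]
  · simp [hω, huG0]
end

section
/- Under Axiom (T.i) (with null events of G equal to subsets of P-null sets) and a state-dependent utility u_G representing the preference via the Conditional Certainty Equivalent: for every f ∈ 𝓛∞(H), g ∈ 𝓛∞(G) and A ∈ G, if g ≺^A f then the event {u_G(g(·),·) ≥ u_G(C(f)(·),·)} ∩ A is P-null, and if g ≻^A f then {u_G(g(·),·) ≤ u_G(C(f)(·),·)} ∩ A is P-null. -/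
open MeasureTheory Set

/-- **Strict local preference and the utility of the CCE**: under Axiom (T.i) and a
state-dependent utility `u_G`, let `cf` be a conditional certainty equivalent of `f`
(`cf ∼ f`). If `g ≺^A f` then `{u_G(g) ≥ u_G(cf)} ∩ A` is `P`-null, and if `g ≻^A f` then
`{u_G(g) ≤ u_G(cf)} ∩ A` is `P`-null. -/
theorem strict_local_preference_null
    {Ω : Type*} [F : MeasurableSpace Ω] (G H : MeasurableSpace Ω)
    (hGH : G ≤ H) (hHF : H ≤ F)
    (P : @MeasureTheory.Measure Ω G) (hP : IsProbabilityMeasure P)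
    (succ prec : (Ω → ℝ) → (Ω → ℝ) → Prop)
    (hT : AxiomT G H P succ prec)
    (uG : ℝ → Ω → ℝ) (huG : StateDepUtility G P uG)
    (f : Ω → ℝ) (hf : BddMeas H f)
    (cf : Ω → ℝ) (hcf : BddMeas G cf) (hcfsim : succ cf f ∧ prec cf f)
    (g : Ω → ℝ) (hg : BddMeas G g)
    (A : Set Ω) (hA : MeasurableSet[G] A) :
    (PrecStrictOn G P succ prec g f A →
      P ({ω | uG (cf ω) ω ≤ uG (g ω) ω} ∩ A) = 0) ∧
    (SuccStrictOn G P succ prec g f A →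
      P ({ω | uG (g ω) ω ≤ uG (cf ω) ω} ∩ A) = 0) := by
  have hcfA : ∀ B : Set Ω, MeasurableSet[G] B →
      succ (B.indicator cf) (B.indicator f) ∧ prec (B.indicator cf) (B.indicator f) := by
    intro B hB
    have h := hT.consistent cf f hcf hf univ B MeasurableSet.univ hB (subset_univ _)
    simp only [indicator_univ] at h
    exact ⟨h.1 hcfsim.1, h.2 hcfsim.2⟩
  have hind : ∀ (K : MeasurableSpace Ω) (h : Ω → ℝ), BddMeas K h → MeasurableSet[K] A →
      BddMeas K (A.indicator h) := by
    intro K h hh hAK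
    obtain ⟨hm, C, hC⟩ := hh
    refine ⟨hm.indicator hAK, C, fun ω => ?_⟩
    by_cases hω : ω ∈ A
    · simpa [hω] using hC ω
    · simpa [hω] using (abs_nonneg _).trans (hC ω)
  have hfA := hind H f hf (hGH _ hA)
  have hgA := hind G g hg hA
  have hcA := hind G cf hcf hA
  have hE : MeasurableSet[G] ({ω | cf ω = g ω} ∩ A) :=
    MeasurableSet.inter (measurableSet_eq_fun hcf.1 hg.1) hA
  have heq : ({ω | cf ω = g ω} ∩ A).indicator cf = ({ω | cf ω = g ω} ∩ A).indicator g := by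
    apply indicator_congr
    intro ω hω
    exact hω.1
  have hsim := hcfA _ hE
  rw [heq] at hsim
  constructor
  · rintro ⟨h1, h2⟩
    have h0 : P ({ω | cf ω = g ω} ∩ A) = 0 := by
      by_contra hne
      exact h2 _ hE inter_subset_right hne hsim
    have h3 := hT.transit _ _ _ hcA hgA hfA (hcfA A hA).1 h1
    refine measure_mono_null ?_ (measure_union_null h3 h0)
    rintro ω ⟨hω, hωA⟩
    have hle : cf ω ≤ g ω := (huG.strictMono ω).le_iff_le.1 hω
    rcases hle.lt_or_eq with h | h
    · left
      simpa [hωA] using h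
    · right
      exact ⟨h, hωA⟩
  · rintro ⟨h1, h2⟩
    have h0 : P ({ω | cf ω = g ω} ∩ A) = 0 := by
      by_contra hne
      exact h2 _ hE inter_subset_right hne hsim
    have h3 := hT.transit _ _ _ hgA hcA hfA h1 (hcfA A hA).2
    refine measure_mono_null ?_ (measure_union_null h3 h0)
    rintro ω ⟨hω, hωA⟩
    have hle : g ω ≤ cf ω := (huG.strictMono ω).le_iff_le.1 hω
    rcases hle.lt_or_eq with h | h
    · left
      simpa [hωA] using h
    · right
      exact ⟨h.symm, hωA⟩
end

section
/- Semigroup property of the Conditional Certainty Equivalent: let 0 ≤ s < t < v, f ∈ 𝓛∞(F_v), and suppose g, g', h are bounded measurable functions with g, g' F_s-measurable and h F_t-measurable, satisfying u_s(g(·),·) = E_P[u_v(f(·),·)|F_s] P-a.s., u_t(h(·),·) = E_P[u_v(f(·),·)|F_t] P-a.s., and u_s(g'(·),·) = E_P[u_t(h(·),·)|F_s] P-a.s. Then g = g' P-a.s.; that is, C_{s,v}(f) = C_{s,t}(C_{t,v}(f)) P-a.s. -/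
open MeasureTheory Set

/-- **Semigroup property of the Conditional Certainty Equivalent**: for `s < t < v`, if
`u_s(g) = E_P[u_v(f)|F_s]` `P`-a.s. (so `g = C_{s,v}(f)`), `u_t(h) = E_P[u_v(f)|F_t]`
`P`-a.s. (so `h = C_{t,v}(f)`) and `u_s(g') = E_P[u_t(h)|F_s]` `P`-a.s.
(so `g' = C_{s,t}(C_{t,v}(f))`), then `g = g'` `P`-a.s. -/
theorem CCE_semigroup
    {Ω : Type*} [mΩ : MeasurableSpace Ω]
    (Fs Ft Fv : MeasurableSpace Ω) (hst : Fs ≤ Ft) (htv : Ft ≤ Fv) (hv : Fv ≤ mΩ)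
    (P : MeasureTheory.Measure Ω) (hP : IsProbabilityMeasure P)
    (us ut uv : ℝ → Ω → ℝ)
    (husmeas : ∀ x : ℝ, Measurable[Fs] (fun ω => us x ω))
    (husint : ∀ x : ℝ, Integrable (fun ω => us x ω) P)
    (husmono : ∀ ω, StrictMono (fun x => us x ω))
    (hutmeas : ∀ x : ℝ, Measurable[Ft] (fun ω => ut x ω))
    (hutint : ∀ x : ℝ, Integrable (fun ω => ut x ω) P)
    (hutmono : ∀ ω, StrictMono (fun x => ut x ω))
    (huvmeas : ∀ x : ℝ, Measurable[Fv] (fun ω => uv x ω))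
    (huvint : ∀ x : ℝ, Integrable (fun ω => uv x ω) P)
    (huvmono : ∀ ω, StrictMono (fun x => uv x ω))
    (f : Ω → ℝ) (hf : BddMeas Fv f)
    (g g' h : Ω → ℝ)
    (hg : BddMeas Fs g) (hg' : BddMeas Fs g') (hh : BddMeas Ft h)
    (hgf : (fun ω => us (g ω) ω) =ᵐ[P] (P[(fun ω => uv (f ω) ω)|Fs]))
    (hhf : (fun ω => ut (h ω) ω) =ᵐ[P] (P[(fun ω => uv (f ω) ω)|Ft]))
    (hg'h : (fun ω => us (g' ω) ω) =ᵐ[P] (P[(fun ω => ut (h ω) ω)|Fs])) :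
    g =ᵐ[P] g' := by
  have h1 := condExp_congr_ae (m := Fs) hhf
  have h2 : P[P[(fun ω => uv (f ω) ω)|Ft]|Fs] =ᵐ[P] P[(fun ω => uv (f ω) ω)|Fs] :=
    condExp_condExp_of_le hst htv
  filter_upwards [hgf, hg'h, h1, h2] with ω a b c d
  exact (husmono ω).injective (a.trans (b.trans (c.trans d)).symm)
end

section
/- Debreu's state-dependent expected utility theorem (finite state space): let Ω = {ω₁,…,ω_n} be a finite state space, acts the functions f : Ω → ℝ (identified with ℝⁿ), ⪰ a binary relation on acts, and suppose at least three states are non-null. Then the following are equivalent: (1) there exist n continuous functions V_j : ℝ → ℝ, strictly increasing for every non-null state j and constant for every null state j, such that V(f) = Σ_{j=1}^n V_j(f(ω_j)) represents ⪰ (i.e. f ⪰ g ⟺ V(f) ≥ V(g)); (2) ⪰ is a reflexive, complete, transitive preference order that is norm continuous, strictly monotone, and satisfies the sure-thing principle. Moreover, W(f) = Σ_j W_j(f(ω_j)) also represents ⪰ if and only if there exist τ₁,…,τ_n ∈ ℝ and σ > 0 with W_j = τ_j + σ V_j for every j. -/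
open Set Finset

open Classical in
/-- `f·1_A + g·1_{A^c}` on a finite state space. -/
noncomputable def paste {n : ℕ} (A : Set (Fin n)) (f g : Fin n → ℝ) : Fin n → ℝ :=
  fun j => if j ∈ A then f j else g j

/-- An event `A` is null for the relation `R` if `f·1_A + g·1_{A^c} ∼ g` for all acts. -/
def NullEvent {n : ℕ} (R : (Fin n → ℝ) → (Fin n → ℝ) → Prop) (A : Set (Fin n)) : Prop :=
  ∀ f g : Fin n → ℝ, R (paste A f g) g ∧ R g (paste A f g)


namespace DebreuAux

/-- Axioms of the core order, on an arbitrary finite index type. -/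
structure Pref {ι : Type*} [DecidableEq ι] (le : (ι → ℝ) → (ι → ℝ) → Prop) : Prop where
  total : ∀ f g, le f g ∨ le g f
  trans : ∀ {f g h}, le f g → le g h → le f h
  cloLo : ∀ f, IsClosed {g | le g f}
  cloUp : ∀ f, IsClosed {g | le f g}
  smono : ∀ f j x y, x < y → ¬ le (Function.update f j y) (Function.update f j x)
  indep : ∀ i j, i ≠ j → ∀ (h h' : ι → ℝ) (x y u v : ℝ),
    le (Function.update (Function.update h i x) j y) (Function.update (Function.update h i u) j v) →
    le (Function.update (Function.update h' i x) j y) (Function.update (Function.update h' i u) j v)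

/-- Two coordinate update. -/
def U {ι : Type*} [DecidableEq ι] (h : ι → ℝ) (i : ι) (x : ℝ) (j : ι) (y : ℝ) : ι → ℝ :=
  Function.update (Function.update h i x) j y

/-- A step in coordinate i is worth a step in coordinate j. -/
def Q {ι : Type*} [DecidableEq ι] (le : (ι → ℝ) → (ι → ℝ) → Prop)
    (i : ι) (x x' : ℝ) (j : ι) (y y' : ℝ) : Prop :=
  ∀ h, le (U h i x' j y) (U h i x j y') ∧ le (U h i x j y') (U h i x' j y)

section core
variable {ι : Type*} [DecidableEq ι] {le : (ι → ℝ) → (ι → ℝ) → Prop}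

lemma U_comm (h : ι → ℝ) {i j : ι} (hij : i ≠ j) (x y : ℝ) : U h i x j y = U h j y i x := by
  unfold U; rw [Function.update_comm hij]

lemma U_cont_left (h : ι → ℝ) (i j : ι) (y : ℝ) : Continuous (fun x => U h i x j y) := by
  unfold U; fun_prop

lemma U_cont_right (h : ι → ℝ) (i j : ι) (x : ℝ) : Continuous (fun y => U h i x j y) := by
  unfold U; fun_prop

lemma Pref.refl (P : Pref le) (f : ι → ℝ) : le f f := (P.total f f).elim id id

lemma Pref.of_not (P : Pref le) {f g : ι → ℝ} (h : ¬ le f g) : le g f :=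
  (P.total f g).resolve_left h

lemma Pref.mono (P : Pref le) (f : ι → ℝ) (j : ι) {x y : ℝ} (h : x ≤ y) :
    le (Function.update f j x) (Function.update f j y) := by
  rcases h.eq_or_lt with rfl | h
  · exact P.refl _
  · exact P.of_not (P.smono f j x y h)

lemma Pref.U_right_lt (P : Pref le) (h : ι → ℝ) (i j : ι) (x : ℝ) {y y' : ℝ} (hy : y < y') :
    ¬ le (U h i x j y') (U h i x j y) := P.smono _ _ _ _ hy

lemma Pref.U_left_lt (P : Pref le) (h : ι → ℝ) {i j : ι} (hij : i ≠ j) (y : ℝ) {x x' : ℝ}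
    (hx : x < x') : ¬ le (U h i x' j y) (U h i x j y) := by
  rw [U_comm _ hij, U_comm _ hij]; exact P.U_right_lt _ _ _ _ hx

lemma Pref.U_left_le (P : Pref le) (h : ι → ℝ) {i j : ι} (hij : i ≠ j) (y : ℝ) {x x' : ℝ}
    (hx : x ≤ x') : le (U h i x j y) (U h i x' j y) := by
  rw [U_comm _ hij, U_comm _ hij]; exact P.mono _ _ hx

lemma Pref.U_right_le (P : Pref le) (h : ι → ℝ) (i j : ι) (x : ℝ) {y y' : ℝ}
    (hy : y ≤ y') : le (U h i x j y) (U h i x j y') := P.mono _ _ hy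

lemma Pref.mono_pi [Fintype ι] (P : Pref le) {f g : ι → ℝ} (h : f ≤ g) : le f g := by
  have key : ∀ s : Finset ι, le f (fun j => if j ∈ s then g j else f j) := by
    intro s
    induction s using Finset.induction_on with
    | empty => simpa using P.refl f
    | insert a s ha ih =>
      refine P.trans ih ?_
      have := P.mono (fun j => if j ∈ s then g j else f j) a (h a)
      convert this using 1
      · ext j; by_cases hj : j = a
        · subst hj; simp [ha]
        · simp [hj]
      · ext j; by_cases hj : j = a
        · subst hj; simp
        · simp [hj]
  simpa using key Finset.univ

lemma Pref.indepU (P : Pref le) {i j : ι} (hij : i ≠ j) (h h' : ι → ℝ) {x y x' y' : ℝ}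
    (H : le (U h i x j y) (U h i x' j y')) : le (U h' i x j y) (U h' i x' j y') :=
  P.indep i j hij h h' x y x' y' H

lemma Q_symm {i j : ι} (hij : i ≠ j) {x x' y y' : ℝ} (H : Q le i x x' j y y') :
    Q le j y y' i x x' := by
  intro h
  have := H h
  rw [U_comm _ hij, U_comm _ hij x y'] at this
  exact ⟨this.2, this.1⟩

lemma U_swap (h : ι → ℝ) {i j k : ι} (_hij : i ≠ j) (hik : i ≠ k) (hjk : j ≠ k) (x y z : ℝ) :
    U (Function.update h k z) i x j y = U (Function.update h j y) i x k z := by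
  unfold U
  ext l
  simp only [Function.update_apply]
  split_ifs <;> simp_all

lemma U_swap_left (h : ι → ℝ) {i j k : ι} (_hij : i ≠ j) (hik : i ≠ k) (hjk : j ≠ k) (x y z : ℝ) :
    U (Function.update h k z) i x j y = U (Function.update h i x) j y k z := by
  unfold U
  ext l
  simp only [Function.update_apply]
  split_ifs <;> simp_all

lemma Pref.Q_trans (P : Pref le) {i j k : ι} (hij : i ≠ j) (hik : i ≠ k) (hjk : j ≠ k)
    {x x' y y' z z' : ℝ} (H1 : Q le i x x' k z z') (H2 : Q le j y y' k z z') :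
    Q le i x x' j y y' := by
  intro h
  have a := H1 (Function.update h j y)
  have b := H2 (Function.update h i x)
  rw [← U_swap h hij hik hjk, ← U_swap h hij hik hjk] at a
  rw [← U_swap_left h hij hik hjk, ← U_swap_left h hij hik hjk] at b
  exact ⟨P.indepU hij _ _ (P.trans a.1 b.2), P.indepU hij _ _ (P.trans b.1 a.2)⟩

lemma Pref.ev1 (P : Pref le) {i j : ι} (hij : i ≠ j) {x x' : ℝ} (hx : x < x') (y : ℝ) :
    ∀ᶠ s in nhds y, ∀ h, ¬ le (U h i x' j y) (U h i x j s) := by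
  have ho : IsOpen {s | ¬ le (U 0 i x' j y) (U 0 i x j s)} :=
    ((P.cloUp (U 0 i x' j y)).preimage (U_cont_right 0 i j x)).isOpen_compl
  have := ho.mem_nhds (show y ∈ _ from P.U_left_lt 0 hij y hx)
  filter_upwards [this] with s hs h hc
  exact hs (P.indepU hij _ _ hc)

lemma Pref.ev2 (P : Pref le) {i j : ι} (hij : i ≠ j) {x x' : ℝ} (hx : x < x') (y : ℝ) :
    ∀ᶠ s in nhds y, ∀ h, ¬ le (U h i x' j s) (U h i x j y) := by
  have ho : IsOpen {s | ¬ le (U 0 i x' j s) (U 0 i x j y)} :=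
    ((P.cloLo (U 0 i x j y)).preimage (U_cont_right 0 i j x')).isOpen_compl
  have := ho.mem_nhds (show y ∈ _ from P.U_left_lt 0 hij y hx)
  filter_upwards [this] with s hs h hc
  exact hs (P.indepU hij _ _ hc)

lemma Pref.solve (P : Pref le) {i j : ι} (hij : i ≠ j) {x X y y' : ℝ} (hy : y < y')
    (hle : x ≤ X) (H : le (U 0 i x j y') (U 0 i X j y)) :
    ∃ x', x < x' ∧ x' ≤ X ∧ Q le i x x' j y y' := by
  have c1 : IsClosed {t | le (U 0 i t j y) (U 0 i x j y')} :=
    (P.cloLo _).preimage (U_cont_left 0 i j y)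
  have c2 : IsClosed {t | le (U 0 i x j y') (U 0 i t j y)} :=
    (P.cloUp _).preimage (U_cont_left 0 i j y)
  obtain ⟨t, ht, h1, h2⟩ := isPreconnected_closed_iff.1 (isPreconnected_Icc (a := x) (b := X)) _ _ c1 c2
    (fun t _ => P.total _ _) ⟨x, ⟨le_rfl, hle⟩, P.U_right_le _ _ _ _ hy.le⟩ ⟨X, ⟨hle, le_rfl⟩, H⟩
  refine ⟨t, lt_of_le_of_ne ht.1 ?_, ht.2, fun h => ⟨P.indepU hij _ _ h1, P.indepU hij _ _ h2⟩⟩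
  rintro rfl
  exact P.U_right_lt _ _ _ _ hy h2

lemma Pref.arch (P : Pref le) {i j : ι} (hij : i ≠ j) {y y' B : ℝ} (hy : y < y')
    (c : ℕ → ℝ) (hB : ∀ k, c k ≤ B) (hc : ∀ k, c k < c (k+1))
    (hQ : ∀ k, Q le i (c k) (c (k+1)) j y y') : False := by
  have hm : Monotone c := (strictMono_nat_of_lt_succ hc).monotone
  have hb : BddAbove (range c) := ⟨B, by rintro _ ⟨k, rfl⟩; exact hB k⟩
  have hl := tendsto_atTop_ciSup hm hb
  set L := ⨆ k, c k
  have hL : ∀ k, c k ≤ L := fun k => le_ciSup hb k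
  have c1 : IsClosed {t | le (U 0 i t j y') (U 0 i L j y)} :=
    (P.cloLo _).preimage (U_cont_left 0 i j y')
  have : le (U 0 i L j y') (U 0 i L j y) := c1.mem_of_tendsto hl
    (Filter.Eventually.of_forall fun k => P.trans (hQ k 0).2 (P.U_left_le 0 hij y (hL (k+1))))
  exact P.U_right_lt _ _ _ _ hy this

/-- Comparison of grid points. -/
lemma Pref.grid_le [Fintype ι] (P : Pref le) (c : ι → ℕ → ℝ) (K : ι → ℕ)
    (hc : ∀ j k, c j k < c j (k+1))
    (hQ : ∀ i j, i ≠ j → ∀ k < K i, ∀ l < K j, Q le i (c i k) (c i (k+1)) j (c j l) (c j (l+1)))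
    (b : ι → ℕ) (hb : b ≤ K) : ∀ (d : ℕ) (a : ι → ℕ), a ≤ K → ∑ j, (a j - b j) = d →
      ∑ j, a j ≤ ∑ j, b j → le (fun j => c j (a j)) (fun j => c j (b j)) := by
  intro d
  induction d with
  | zero =>
    intro a _ h0 _
    refine P.mono_pi fun j => ?_
    have h1 := (Finset.sum_eq_zero_iff.1 h0) j (Finset.mem_univ j)
    exact (strictMono_nat_of_lt_succ (hc j)).monotone (by omega)
  | succ d ih =>
    intro a ha hd hab
    obtain ⟨i, hi⟩ : ∃ i, b i < a i := by
      by_contra hcon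
      push Not at hcon
      have : ∑ j, (a j - b j) = 0 := Finset.sum_eq_zero fun j _ => by have := hcon j; omega
      omega
    obtain ⟨j, hj⟩ : ∃ j, a j < b j := by
      by_contra hcon
      push Not at hcon
      have : ∑ j, b j < ∑ j, a j := Finset.sum_lt_sum (fun j _ => hcon j) ⟨i, Finset.mem_univ i, hi⟩
      omega
    have hij : i ≠ j := by rintro rfl; omega
    set a' : ι → ℕ := Function.update (Function.update a i (a i - 1)) j (a j + 1) with ha'
    have a'i : a' i = a i - 1 := by simp [ha', hij]
    have a'j : a' j = a j + 1 := by simp [ha']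
    have a'o : ∀ l, l ≠ i → l ≠ j → a' l = a l := by intro l h1 h2; simp [ha', h1, h2]
    have split : ∀ F : ι → ℕ, ∑ l, F l = F i + (F j + ∑ l ∈ (univ.erase i).erase j, F l) := by
      intro F
      rw [Finset.add_sum_erase _ _ (by simp [hij.symm]), Finset.add_sum_erase _ _ (by simp)]
    have e1 : ∑ l ∈ (univ.erase i).erase j, a' l = ∑ l ∈ (univ.erase i).erase j, a l :=
      Finset.sum_congr rfl fun l hl => a'o l (by simp at hl; tauto) (by simp at hl; tauto)
    have e2 : ∑ l ∈ (univ.erase i).erase j, (a' l - b l) = ∑ l ∈ (univ.erase i).erase j, (a l - b l) :=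
      Finset.sum_congr rfl fun l hl => by rw [a'o l (by simp at hl; tauto) (by simp at hl; tauto)]
    have hle := ih a' (by
      intro l
      change a' l ≤ K l
      by_cases h1 : l = j
      · subst h1; rw [a'j]; have : b l ≤ K l := hb l; omega
      by_cases h2 : l = i
      · subst h2; rw [a'i]; have : a l ≤ K l := ha l; omega
      rw [a'o l h2 h1]; exact ha l) (by
        have s1 := split (fun l => a' l - b l)
        have s2 := split (fun l => a l - b l)
        simp only [e2, a'i, a'j] at s1 s2
        omega) (by
        have s1 := split a'
        have s2 := split a
        simp only [e1, a'i, a'j] at s1 s2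
        omega)
    refine P.trans ?_ hle
    have := (hQ i j hij (a i - 1) (by have : a i ≤ K i := ha i; omega) (a j) (by have : b j ≤ K j := hb j; omega)
      (fun l => c l (a l))).1
    convert this using 1
    · ext l
      have : a i - 1 + 1 = a i := by omega
      simp only [U, Function.update_apply, this]
      split_ifs <;> simp_all
    · ext l
      simp only [U, Function.update_apply]
      by_cases h1 : l = j
      · subst h1; simp [a'j]
      by_cases h2 : l = i
      · subst h2; simp [a'i, h1]
      simp [h1, h2, a'o]

lemma Pref.grid_lt [Fintype ι] (P : Pref le) (c : ι → ℕ → ℝ) (K : ι → ℕ)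
    (hc : ∀ j k, c j k < c j (k+1))
    (hQ : ∀ i j, i ≠ j → ∀ k < K i, ∀ l < K j, Q le i (c i k) (c i (k+1)) j (c j l) (c j (l+1)))
    (b : ι → ℕ) (hb : b ≤ K) (a : ι → ℕ) (ha : a ≤ K)
    (hab : le (fun j => c j (b j)) (fun j => c j (a j))) : ∑ j, b j ≤ ∑ j, a j := by
  by_contra hlt
  push Not at hlt
  obtain ⟨j, hj⟩ : ∃ j, a j < b j := by
    by_contra hcon
    push Not at hcon
    have : ∑ j, b j ≤ ∑ j, a j := Finset.sum_le_sum (fun j _ => hcon j)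
    omega
  have h1 := P.grid_le c K hc hQ b hb _ (Function.update a j (a j + 1)) (by
    intro l
    by_cases h1 : l = j
    · subst h1; have : b l ≤ K l := hb l; simp; omega
    · simp [h1]; exact ha l) rfl (by
      rw [Finset.sum_update_of_mem (Finset.mem_univ j)]
      rw [← Finset.add_sum_erase _ a (Finset.mem_univ j)] at hlt
      rw [Finset.sdiff_singleton_eq_erase]
      omega)
  have h2 := P.trans h1 hab
  refine P.smono (fun l => c l (a l)) j (c j (a j)) (c j (a j + 1)) (hc _ _) ?_
  convert h2 using 1
  · ext l
    by_cases h1 : l = j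
    · subst h1; simp
    · simp [h1]
  · simp

lemma Pref.steps [Fintype ι] (P : Pref le) {i1 i2 i3 : ι} (h12 : i1 ≠ i2) (h13 : i1 ≠ i3)
    (h23 : i2 ≠ i3) (B : ℝ) (hB : 1 ≤ B) (M : ℕ) :
    ∃ T : ι → ℝ → ℝ, (∀ j x, x < T j x) ∧
      (∀ i j, i ≠ j → ∀ x ≤ B, ∀ y ≤ B, Q le i x (T i x) j y (T j y)) ∧
      (∀ j, ∀ c : ℕ → ℝ, (∀ k, c k ≤ B) → (∀ k, c (k+1) = T j (c k)) → False) ∧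
      (∀ k < M, ∀ x : ℝ, x ≤ k / M → T i1 x ≤ (k + 1 : ℝ) / M) := by
  classical
  -- size of the rod in coordinate i2
  obtain ⟨δ, hδ, hδB⟩ : ∃ δ > (0:ℝ), le (U 0 i3 B i2 δ) (U 0 i3 (B+1) i2 0) := by
    have h := P.ev1 h23.symm (show B < B + 1 by linarith) 0
    have h' := (h.filter_mono (nhdsWithin_le_nhds (s := Ioi 0))).and self_mem_nhdsWithin
    obtain ⟨δ, h1, h2⟩ := h'.exists
    exact ⟨δ, h2, P.of_not (h1 0)⟩
  obtain ⟨s, hs0, hs1, hs2, hs3⟩ : ∃ s > (0:ℝ), le (U 0 i2 0 i3 s) (U 0 i2 δ i3 0) ∧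
      (∀ j, j ≠ i3 → le (U 0 j B i3 s) (U 0 j (B+1) i3 0)) ∧
      (∀ k < M, ¬ le (U 0 i1 ((k+1:ℝ)/M) i3 0) (U 0 i1 ((k:ℝ)/M) i3 s)) := by
    have e1 := P.ev1 h23 hδ 0
    have e2 : ∀ᶠ s in nhds (0:ℝ), ∀ j, j ≠ i3 → le (U 0 j B i3 s) (U 0 j (B+1) i3 0) := by
      rw [Filter.eventually_all]
      intro j
      by_cases hj : j = i3
      · simp [hj]
      · filter_upwards [P.ev1 hj (show B < B + 1 by linarith) 0] with s hs _
        exact P.of_not (hs 0)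
    have e3 : ∀ᶠ s in nhds (0:ℝ), ∀ k ∈ Finset.range M,
        ¬ le (U 0 i1 ((k+1:ℝ)/M) i3 0) (U 0 i1 ((k:ℝ)/M) i3 s) := by
      rw [Filter.eventually_all_finset]
      intro k hk
      have hM : (0:ℝ) < M := by
        have := Finset.mem_range.1 hk
        exact_mod_cast (by omega : 0 < M)
      filter_upwards [P.ev1 h13 (show (k:ℝ)/M < (k+1)/M by gcongr; linarith) 0] with s hs
      exact hs 0
    have h := e1.and (e2.and e3)
    have h' := (h.filter_mono (nhdsWithin_le_nhds (s := Ioi 0))).and self_mem_nhdsWithin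
    obtain ⟨s, ⟨a1, a2, a3⟩, a4⟩ := h'.exists
    exact ⟨s, a4, P.of_not (a1 0), a2, fun k hk => a3 k (Finset.mem_range.2 hk)⟩
  have hex : ∀ j, j ≠ i3 → ∀ x ≤ B, ∃ x', x < x' ∧ Q le j x x' i3 0 s := by
    intro j hj x hx
    obtain ⟨x', h1, _, h3⟩ := P.solve hj hs0 (show x ≤ B + 1 by linarith)
      (P.trans (P.U_left_le 0 hj s hx) (hs2 j hj))
    exact ⟨x', h1, h3⟩
  obtain ⟨p, hp0, hpδ, hp⟩ := P.solve h23 hs0 hδ.le hs1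
  have hex3 : ∀ x ≤ B, ∃ x', x < x' ∧ Q le i3 x x' i2 0 p := by
    intro x hx
    obtain ⟨x', h1, _, h3⟩ := P.solve h23.symm hp0 (show x ≤ B + 1 by linarith)
      (P.trans (P.U_left_le 0 h23.symm p hx) (P.trans (P.U_right_le 0 _ _ _ hpδ) hδB))
    exact ⟨x', h1, h3⟩
  have hall : ∀ j x, ∃ x', x < x' ∧ (x ≤ B → (j ≠ i3 → Q le j x x' i3 0 s) ∧
      (j = i3 → Q le i3 x x' i2 0 p)) := by
    intro j x
    by_cases hx : x ≤ B
    · by_cases hj : j = i3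
      · obtain ⟨x', h1, h2⟩ := hex3 x hx
        exact ⟨x', h1, fun _ => ⟨fun h => (h hj).elim, fun _ => h2⟩⟩
      · obtain ⟨x', h1, h2⟩ := hex j hj x hx
        exact ⟨x', h1, fun _ => ⟨fun _ => h2, fun h => (hj h).elim⟩⟩
    · exact ⟨x + 1, by linarith, fun h => (hx h).elim⟩
  choose T hT1 hT2 using hall
  have T3 : ∀ j, j ≠ i3 → ∀ x ≤ B, Q le j x (T j x) i3 0 s := fun j hj x hx => (hT2 j x hx).1 hj
  have T4 : ∀ x ≤ B, Q le i3 x (T i3 x) i2 0 p := fun x hx => (hT2 i3 x hx).2 rfl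
  -- exchange with neither index equal to i3
  have X0 : ∀ i j, i ≠ j → i ≠ i3 → j ≠ i3 → ∀ x ≤ B, ∀ y ≤ B, Q le i x (T i x) j y (T j y) :=
    fun i j hij hi hj x hx y hy => P.Q_trans hij hi hj (T3 i hi x hx) (T3 j hj y hy)
  have X1 : ∀ j, j ≠ i3 → j ≠ i2 → ∀ x ≤ B, ∀ y ≤ B, Q le i3 x (T i3 x) j y (T j y) := by
    intro j hj hj2 x hx y hy
    exact P.Q_trans hj.symm h23.symm hj2 (T4 x hx) (P.Q_trans hj2 hj h23 (T3 j hj y hy) hp)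
  have X2 : ∀ x ≤ B, ∀ y ≤ B, Q le i3 x (T i3 x) i2 y (T i2 y) := by
    intro x hx y hy
    exact P.Q_trans h23.symm h13.symm h12.symm (X1 i1 h13 h12 x hx 0 (by linarith))
      (X0 i2 i1 h12.symm h23 h13 y hy 0 (by linarith))
  have X3 : ∀ j, j ≠ i3 → ∀ x ≤ B, ∀ y ≤ B, Q le i3 x (T i3 x) j y (T j y) := by
    intro j hj
    by_cases h : j = i2
    · subst h; exact X2
    · exact X1 j hj h
  refine ⟨T, hT1, ?_, ?_, ?_⟩
  · intro i j hij x hx y hy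
    by_cases hi : i = i3
    · subst hi; exact X3 j hij.symm x hx y hy
    by_cases hj : j = i3
    · subst hj; exact Q_symm hij.symm (X3 i hi y hy x hx)
    exact X0 i j hij hi hj x hx y hy
  · intro j c hc hcT
    have hlt : ∀ k, c k < c (k+1) := fun k => by rw [hcT]; exact hT1 _ _
    by_cases hj : j = i3
    · subst hj
      exact P.arch h23.symm hp0 c hc hlt fun k => by rw [hcT]; exact T4 _ (hc k)
    · exact P.arch hj hs0 c hc hlt fun k => by rw [hcT]; exact T3 j hj _ (hc k)
  · intro k hk x hx
    have hM : (0:ℝ) < M := by exact_mod_cast (by omega : 0 < M)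
    have hkM : (k:ℝ)/M ≤ 1 := by rw [div_le_one hM]; exact_mod_cast hk.le
    by_contra hlt
    push Not at hlt
    refine hs3 k hk ?_
    refine P.trans (P.U_left_le 0 h13 0 hlt.le) ?_
    exact P.trans (T3 i1 h13 x (by linarith) 0).1 (P.U_left_le 0 h13 s hx)

/-- Approximate additive representation on a box. -/
lemma Pref.approx [Fintype ι] (P : Pref le) {i1 i2 i3 : ι} (h12 : i1 ≠ i2) (h13 : i1 ≠ i3)
    (h23 : i2 ≠ i3) (B : ℝ) (hB : 1 ≤ B) (M : ℕ) (hM : 0 < M) :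
    ∃ N : ι → ℝ → ℕ, (∀ f g : ι → ℝ, (∀ j, |f j| ≤ B) → (∀ j, |g j| ≤ B) → le f g →
      ∑ j, N j (f j) ≤ ∑ j, N j (g j) + Fintype.card ι) ∧ N i1 0 + M ≤ N i1 1 := by
  classical
  obtain ⟨T, T1, T2, T3, T4⟩ := P.steps h12 h13 h23 B hB M
  set c : ι → ℕ → ℝ := fun j k => (T j)^[k] (-B) with hcdef
  have c0 : ∀ j, c j 0 = -B := fun j => rfl
  have cs : ∀ j k, c j (k+1) = T j (c j k) := fun j k => Function.iterate_succ_apply' _ _ _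
  have clt : ∀ j k, c j k < c j (k+1) := fun j k => by rw [cs]; exact T1 _ _
  have cm : ∀ j, StrictMono (c j) := fun j => strictMono_nat_of_lt_succ (clt j)
  have hK : ∀ j, ∃ K, B < c j K := by
    intro j
    by_contra hcon
    push Not at hcon
    exact T3 j (c j) hcon (cs j)
  have hN : ∀ j x, ∃ k, |x| ≤ B → c j k ≤ x ∧ x < c j (k+1) := by
    intro j x
    by_cases hx : |x| ≤ B
    · have hx' := abs_le.1 hx
      have hex : ∃ k, x < c j k := by
        obtain ⟨K, hK⟩ := hK j
        exact ⟨K, by linarith⟩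
      have hs := Nat.find_spec hex
      have hpos : Nat.find hex ≠ 0 := by
        intro h0
        rw [h0, c0] at hs
        linarith
      obtain ⟨k, hk⟩ := Nat.exists_eq_succ_of_ne_zero hpos
      refine ⟨k, fun _ => ⟨?_, by rw [hk] at hs; exact hs⟩⟩
      have := Nat.find_min hex (show k < Nat.find hex by omega)
      exact not_lt.1 this
    · exact ⟨0, fun h => (hx h).elim⟩
  choose N hN using hN
  refine ⟨N, ?_, ?_⟩
  · intro f g hf hg hfg
    set K : ι → ℕ := fun j => Nat.find (hK j)
    have hKlt : ∀ j k, k < K j → c j k ≤ B := fun j k hk => not_lt.1 (Nat.find_min (hK j) hk)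
    have hNK : ∀ j x, |x| ≤ B → N j x < K j := by
      intro j x hx
      have h1 := (hN j x hx).1
      have h2 : B < c j (K j) := Nat.find_spec (hK j)
      exact (cm j).lt_iff_lt.1 (by have := (abs_le.1 hx).2; linarith)
    have := P.grid_lt c K clt (fun i j hij k hk l hl => by
        rw [cs, cs]; exact T2 i j hij _ (hKlt i k hk) _ (hKlt j l hl))
      (fun j => N j (f j)) (fun j => (hNK j _ (hf j)).le)
      (fun j => N j (g j) + 1) (fun j => hNK j _ (hg j))
      (P.trans (P.mono_pi fun j => (hN j _ (hf j)).1)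
        (P.trans hfg (P.mono_pi fun j => (hN j _ (hg j)).2.le)))
    rw [Finset.sum_add_distrib] at this
    simpa using this
  · have h0 := hN i1 0 (by simp; linarith)
    have h1 := hN i1 1 (by simpa using hB)
    have hM' : (0:ℝ) < M := by exact_mod_cast hM
    have key : ∀ i ≤ M, c i1 (N i1 0 + i) ≤ (i:ℝ)/M := by
      intro i
      induction i with
      | zero => intro _; simpa using h0.1
      | succ i ih =>
        intro hi
        rw [← add_assoc, cs]
        push_cast
        exact T4 i (by omega) _ (ih (by omega))
    have h2 := key M le_rfl
    rw [div_self hM'.ne'] at h2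
    have := (cm i1).lt_iff_lt.1 (h2.trans_lt h1.2)
    omega

lemma sum_U [Fintype ι] (F : ι → ℝ → ℝ) (h : ι → ℝ) {i j : ι} (hij : i ≠ j) (x y : ℝ) :
    ∑ l, F l (U h i x j y l) = F i x + (F j y + ∑ l ∈ (univ.erase i).erase j, F l (h l)) := by
  rw [← Finset.add_sum_erase _ _ (Finset.mem_univ i),
    ← Finset.add_sum_erase (univ.erase i) _ (show j ∈ univ.erase i by simp [hij.symm])]
  congr 1
  · simp [U, hij]
  · congr 1
    · simp [U]
    · refine Finset.sum_congr rfl fun l hl => ?_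
      simp only [Finset.mem_erase] at hl
      simp [U, hl.1, hl.2.1]

lemma conn {E : ℝ → ℝ → Prop} (hs : ∀ x y, E x y → E y x) (ht : ∀ x y z, E x y → E y z → E x z)
    (hn : ∀ z, ∀ᶠ w in nhds z, E z w) (x y : ℝ) : E x y := by
  refine isPreconnected_univ.induction₂ E (fun z _ => ?_) (fun x y z _ _ _ => ht x y z)
    (fun x y _ _ => hs x y) (Set.mem_univ x) (Set.mem_univ y)
  exact (hn z).filter_mono nhdsWithin_le_nhds

lemma Pref.near (P : Pref le) {i j : ι} (hij : i ≠ j) {y y' : ℝ} (hy : y < y') (z : ℝ) :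
    ∀ᶠ w in nhds z, le (U 0 i y j w) (U 0 i y' j z) ∧ le (U 0 i y j z) (U 0 i y' j w) := by
  filter_upwards [P.ev1 hij hy z, P.ev2 hij hy z] with w h1 h2
  exact ⟨P.of_not (h1 0), P.of_not (h2 0)⟩

lemma Pref.bdd_step [Fintype ι] (P : Pref le) (v : ℕ → ι → ℝ → ℝ)
    (hv : ∀ f g, le f g → ∀ᶠ m : ℕ in Filter.atTop,
      ∑ j, v m j (f j) ≤ ∑ j, v m j (g j) + (Fintype.card ι : ℝ) / (m + 1))
    {i j : ι} (hij : i ≠ j) {y y' : ℝ} (hy : y < y')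
    (hb : ∃ C, ∀ᶠ m : ℕ in Filter.atTop, |v m i y' - v m i y| ≤ C) (x x' : ℝ) :
    ∃ C, ∀ᶠ m : ℕ in Filter.atTop, |v m j x - v m j x'| ≤ C := by
  refine conn (E := fun x x' => ∃ C, ∀ᶠ m : ℕ in Filter.atTop, |v m j x - v m j x'| ≤ C)
    ?_ ?_ ?_ x x'
  · rintro x y ⟨C, hC⟩
    exact ⟨C, by simpa only [abs_sub_comm] using hC⟩
  · rintro x y z ⟨C, hC⟩ ⟨D, hD⟩
    refine ⟨C + D, ?_⟩
    filter_upwards [hC, hD] with m h1 h2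
    exact (abs_sub_le _ _ _).trans (add_le_add h1 h2)
  · intro z
    obtain ⟨C, hC⟩ := hb
    filter_upwards [P.near hij hy z] with w hw
    refine ⟨C + Fintype.card ι, ?_⟩
    filter_upwards [hC, hv _ _ hw.1, hv _ _ hw.2] with m h0 h1 h2
    rw [sum_U _ _ hij, sum_U _ _ hij] at h1 h2
    have h3 : (Fintype.card ι : ℝ) / (m + 1) ≤ Fintype.card ι :=
      div_le_self (by positivity) (by have : (0:ℝ) ≤ m := by positivity
                                      linarith)
    have h4 := abs_le.1 h0
    rw [abs_le]
    constructor <;> linarith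

lemma ulim (u : ℕ → ℝ) (h : ∃ C, ∀ᶠ m : ℕ in Filter.atTop, |u m| ≤ C) :
    ∃ a, Filter.Tendsto u (Filter.hyperfilter ℕ : Filter ℕ) (nhds a) := by
  obtain ⟨C, hC⟩ := h
  have hC' : ∀ᶠ m in (Filter.hyperfilter ℕ : Filter ℕ), u m ∈ Icc (-C) C := by
    refine Filter.Eventually.filter_mono Nat.hyperfilter_le_atTop ?_
    filter_upwards [hC] with m hm
    exact abs_le.1 hm
  obtain ⟨a, _, ha⟩ := isCompact_Icc.ultrafilter_le_nhds ((Filter.hyperfilter ℕ).map u)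
    (Filter.le_principal_iff.2 hC')
  exact ⟨a, ha⟩

lemma Pref.weak_rep [Fintype ι] (P : Pref le) {i1 i2 i3 : ι} (h12 : i1 ≠ i2) (h13 : i1 ≠ i3)
    (h23 : i2 ≠ i3) : ∃ V : ι → ℝ → ℝ, V i1 0 = 0 ∧ V i1 1 = 1 ∧
      ∀ f g, le f g → ∑ j, V j (f j) ≤ ∑ j, V j (g j) := by
  have hap := fun m : ℕ => P.approx h12 h13 h23 ((m:ℝ) + 1)
    (by have : (0:ℝ) ≤ m := by positivity
        linarith) (m+1) (by omega)
  choose N hN1 hN2 using hap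
  set D : ℕ → ℝ := fun m => (N m i1 1 : ℝ) - N m i1 0 with hD
  have hDm : ∀ m : ℕ, (m:ℝ) + 1 ≤ D m := by
    intro m
    have : ((N m i1 0 + (m+1) : ℕ) : ℝ) ≤ N m i1 1 := by exact_mod_cast hN2 m
    push_cast at this
    simp only [hD]; linarith
  have hDpos : ∀ m, 0 < D m := fun m => lt_of_lt_of_le (by positivity) (hDm m)
  set v : ℕ → ι → ℝ → ℝ := fun m j x => ((N m j x : ℝ) - N m j 0) / D m with hvdef
  have v0 : ∀ m j, v m j 0 = 0 := by intro m j; simp [hvdef]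
  have v1 : ∀ m, v m i1 1 = 1 := by intro m; exact div_self (hDpos m).ne'
  have hv : ∀ f g, le f g → ∀ᶠ m : ℕ in Filter.atTop,
      ∑ j, v m j (f j) ≤ ∑ j, v m j (g j) + (Fintype.card ι : ℝ) / (m + 1) := by
    intro f g hfg
    have hbd : ∀ f : ι → ℝ, ∀ᶠ m : ℕ in Filter.atTop, ∀ j, |f j| ≤ (m:ℝ) + 1 := by
      intro f
      rw [Filter.eventually_all]
      intro j
      filter_upwards [Filter.eventually_ge_atTop ⌈|f j|⌉₊] with m hm
      have := Nat.ceil_le.1 hm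
      linarith
    filter_upwards [hbd f, hbd g] with m hf hg
    have h1 : ((∑ j, N m j (f j) : ℕ) : ℝ) ≤ ((∑ j, N m j (g j) + Fintype.card ι : ℕ) : ℝ) := by
      exact_mod_cast hN1 m f g hf hg hfg
    push_cast at h1
    have h2 : (Fintype.card ι : ℝ) / D m ≤ (Fintype.card ι : ℝ) / (m + 1) :=
      div_le_div_of_nonneg_left (by positivity) (by positivity) (hDm m)
    refine le_trans ?_ (add_le_add_right h2 _)
    simp only [hvdef, ← Finset.sum_div, ← add_div]
    refine div_le_div_of_nonneg_right ?_ (hDpos m).le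
    rw [Finset.sum_sub_distrib, Finset.sum_sub_distrib]
    linarith
  have b1 : ∀ j, i1 ≠ j → ∀ x x', ∃ C, ∀ᶠ m : ℕ in Filter.atTop, |v m j x - v m j x'| ≤ C :=
    fun j hj => P.bdd_step v hv hj (show (0:ℝ) < 1 by norm_num)
      ⟨1, Filter.Eventually.of_forall fun m => by rw [v0, v1]; norm_num⟩
  have b2 : ∀ j x x', ∃ C, ∀ᶠ m : ℕ in Filter.atTop, |v m j x - v m j x'| ≤ C := by
    intro j
    by_cases hj : i1 = j
    · subst hj
      exact P.bdd_step v hv h12.symm (show (0:ℝ) < 1 by norm_num) (b1 i2 h12 1 0)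
    · exact b1 j hj
  have hl : ∀ j x, ∃ a, Filter.Tendsto (fun m => v m j x) (Filter.hyperfilter ℕ : Filter ℕ) (nhds a) :=
    fun j x => ulim _ (by simpa [v0] using b2 j x 0)
  choose V hV using hl
  refine ⟨V, ?_, ?_, ?_⟩
  · exact tendsto_nhds_unique (hV i1 0) (by simp only [v0]; exact tendsto_const_nhds)
  · exact tendsto_nhds_unique (hV i1 1) (by simp only [v1]; exact tendsto_const_nhds)
  · intro f g hfg
    have t1 := tendsto_finsetSum Finset.univ fun j _ => hV j (f j)
    have t2 := tendsto_finsetSum Finset.univ fun j _ => hV j (g j)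
    have t3 : Filter.Tendsto (fun m : ℕ => (Fintype.card ι : ℝ) / (m + 1))
        (Filter.hyperfilter ℕ : Filter ℕ) (nhds 0) := by
      refine Filter.Tendsto.mono_left ?_ Nat.hyperfilter_le_atTop
      have := (tendsto_one_div_add_atTop_nhds_zero_nat (𝕜 := ℝ)).const_mul (Fintype.card ι : ℝ)
      simpa [div_eq_mul_inv] using this
    have t4 := t2.add t3
    rw [add_zero] at t4
    exact le_of_tendsto_of_tendsto t1 t4 ((hv f g hfg).filter_mono Nat.hyperfilter_le_atTop)

lemma exists_small {u : ℝ → ℝ} (hu : Monotone u) {ε : ℝ} (hε : 0 < ε) :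
    ∃ y y', y < y' ∧ u y' - u y < ε := by
  obtain ⟨y, hy⟩ : ∃ y, ContinuousAt u y := by
    by_contra hcon
    push Not at hcon
    have h := hu.countable_not_continuousAt
    have : {x | ¬ ContinuousAt u x} = Set.univ := by ext x; simp [hcon x]
    rw [this] at h
    exact Cardinal.not_countable_real h
  have h1 : ∀ᶠ t in nhds y, u t < u y + ε := hy.eventually (gt_mem_nhds (by linarith))
  obtain ⟨t, h2, h3⟩ := ((h1.filter_mono (nhdsWithin_le_nhds (s := Ioi y))).and
    self_mem_nhdsWithin).exists
  exact ⟨y, t, h3, by linarith⟩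

theorem Pref.rep [Fintype ι] (P : Pref le) {i1 i2 i3 : ι} (h12 : i1 ≠ i2) (h13 : i1 ≠ i3)
    (h23 : i2 ≠ i3) : ∃ V : ι → ℝ → ℝ, (∀ j, Continuous (V j)) ∧ (∀ j, StrictMono (V j)) ∧
      ∀ f g, le f g ↔ ∑ j, V j (f j) ≤ ∑ j, V j (g j) := by
  obtain ⟨V, V0, V1, hV⟩ := P.weak_rep h12 h13 h23
  have near : ∀ i j, i ≠ j → ∀ y y', y < y' → ∀ z, ∀ᶠ w in nhds z,
      |V j w - V j z| ≤ V i y' - V i y := by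
    intro i j hij y y' hy z
    filter_upwards [P.near hij hy z] with w hw
    have h1 := hV _ _ hw.1
    have h2 := hV _ _ hw.2
    rw [sum_U _ _ hij, sum_U _ _ hij] at h1 h2
    rw [abs_le]; constructor <;> linarith
  have other : ∀ j : ι, ∃ i, i ≠ j := by
    intro j
    by_cases h : i1 = j
    · exact ⟨i2, by rw [← h]; exact h12.symm⟩
    · exact ⟨i1, h⟩
  have mono : ∀ j, Monotone (V j) := by
    intro j x y hxy
    obtain ⟨i, hi⟩ := other j
    have := hV _ _ (P.U_right_le 0 i j 0 hxy)
    rw [sum_U _ _ hi, sum_U _ _ hi] at this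
    linarith
  have flat : ∀ i j, i ≠ j → ∀ y y', y < y' → V i y' ≤ V i y → ∀ x x', V j x = V j x' := by
    intro i j hij y y' hy hle
    refine conn (fun x y h => h.symm) (fun x y z h1 h2 => h1.trans h2) fun z => ?_
    filter_upwards [near i j hij y y' hy z] with w hw
    have := abs_nonpos_iff.1 (hw.trans (by linarith))
    linarith
  have flat1 : ∀ i, i ≠ i1 → ∀ y y', y < y' → V i y < V i y' := by
    intro i hi y y' hy
    by_contra hcon
    have := flat i i1 hi y y' hy (not_lt.1 hcon) 0 1
    rw [V0, V1] at this; norm_num at this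
  have smono : ∀ j, StrictMono (V j) := by
    intro j x y hxy
    by_cases hj : j = i1
    · subst hj
      by_contra hcon
      have h1 := flat j i2 h12 x y hxy (not_lt.1 hcon) 0 1
      have h2 := flat1 i2 h12.symm 0 1 (by norm_num)
      linarith
    · exact flat1 j hj x y hxy
  refine ⟨V, ?_, smono, fun f g => ⟨hV f g, ?_⟩⟩
  · intro j
    rw [continuous_iff_continuousAt]
    intro z
    obtain ⟨i, hi⟩ := other j
    rw [Metric.continuousAt_iff']
    intro ε hε
    obtain ⟨y, y', hy, hs⟩ := exists_small (mono i) hε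
    filter_upwards [near i j hi y y' hy z] with w hw
    rw [Real.dist_eq]; linarith
  · intro hle
    by_contra hcon
    -- perturb g upwards
    have ho' : IsOpen {t : ℝ | ¬ le f (Function.update g i1 t)} :=
      ((P.cloUp f).preimage (by fun_prop : Continuous fun t => Function.update g i1 t)).isOpen_compl
    have hmem : g i1 ∈ {t : ℝ | ¬ le f (Function.update g i1 t)} := by simpa using hcon
    have h1 := ho'.mem_nhds hmem
    obtain ⟨t, h2, h3⟩ := (Filter.Eventually.and (Filter.Eventually.filter_mono
      (nhdsWithin_le_nhds (s := Ioi (g i1))) h1) self_mem_nhdsWithin).exists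
    have h4 := hV _ _ (P.of_not h2)
    have h5 : ∑ j, V j (g j) < ∑ j, V j (Function.update g i1 t j) := by
      refine Finset.sum_lt_sum (fun j _ => ?_) ⟨i1, Finset.mem_univ _, by simpa using smono i1 h3⟩
      by_cases hj : j = i1
      · subst hj; simpa using (smono j h3).le
      · simp [hj]
    linarith

end core

/-- Midpoint rigidity. -/
lemma rigid {V1 V2 W1 W2 : ℝ → ℝ} (c1 : Continuous V1) (c2 : Continuous V2)
    (m1 : StrictMono V1) (m2 : StrictMono V2) (cW : Continuous W1)
    (H : ∀ x x' y y', V1 x' - V1 x = V2 y' - V2 y → W1 x' - W1 x = W2 y' - W2 y)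
    {a b : ℝ} (hab : a < b) (κ τ : ℝ) (ha : W1 a = τ + κ * V1 a) (hb : W1 b = τ + κ * V1 b) :
    ∀ x ∈ Icc a b, W1 x ≤ τ + κ * V1 x := by
  set G : ℝ → ℝ := fun x => W1 x - κ * V1 x - τ with hG
  have cG : Continuous G := by fun_prop
  obtain ⟨z, hz, hmax⟩ := isCompact_Icc.exists_isMaxOn (nonempty_Icc.2 hab.le) cG.continuousOn
  by_contra hcon
  push Not at hcon
  obtain ⟨w, hw, hw'⟩ := hcon
  have hpos : 0 < G z := lt_of_lt_of_le (by simp only [hG]; linarith) (hmax hw)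
  have hS : IsCompact (Icc a b ∩ {x | G x = G z}) :=
    isCompact_Icc.inter_right (isClosed_eq cG continuous_const)
  obtain ⟨t, ⟨ht, htz⟩, hmin⟩ := hS.exists_isLeast ⟨z, hz, rfl⟩
  have htz : G t = G z := htz
  have hta : a < t := lt_of_le_of_ne ht.1 (by
    rintro rfl
    have : G a = 0 := by simp only [hG]; linarith
    linarith)
  have htb : t < b := lt_of_le_of_ne ht.2 (by
    rintro rfl
    have : G t = 0 := by simp only [hG]; linarith
    linarith)
  -- small step
  obtain ⟨δ, hδ, d1, d2, d3⟩ : ∃ δ > 0, δ ≤ V1 t - V1 a ∧ δ ≤ V1 b - V1 t ∧ δ ≤ V2 1 - V2 0 := by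
    have e1 := m1 hta
    have e2 := m1 htb
    have e3 := m2 (show (0:ℝ) < 1 by norm_num)
    refine ⟨min (V1 t - V1 a) (min (V1 b - V1 t) (V2 1 - V2 0)), ?_, min_le_left _ _,
      (min_le_right _ _).trans (min_le_left _ _), (min_le_right _ _).trans (min_le_right _ _)⟩
    simp only [gt_iff_lt, lt_min_iff]
    refine ⟨?_, ?_, ?_⟩ <;> linarith
  obtain ⟨l, hl, hl'⟩ := intermediate_value_Icc hta.le c1.continuousOn
    (show V1 t - δ ∈ Icc (V1 a) (V1 t) from ⟨by linarith, by linarith⟩)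
  obtain ⟨r, hr, hr'⟩ := intermediate_value_Icc htb.le c1.continuousOn
    (show V1 t + δ ∈ Icc (V1 t) (V1 b) from ⟨by linarith, by linarith⟩)
  obtain ⟨y, hy, hy'⟩ := intermediate_value_Icc (show (0:ℝ) ≤ 1 by norm_num) c2.continuousOn
    (show V2 0 + δ ∈ Icc (V2 0) (V2 1) from ⟨by linarith, by linarith⟩)
  have q1 := H t r 0 y (by linarith)
  have q2 := H l t 0 y (by linarith)
  have hGl : G l ≤ G z := hmax ⟨hl.1, hl.2.trans ht.2⟩
  have hGr : G r ≤ G z := hmax ⟨ht.1.trans hr.1, hr.2⟩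
  have hmid : G l + G r = 2 * G t := by
    simp only [hG]; rw [hl', hr']; linarith
  have : G l = G z := by linarith
  have h1 := hmin ⟨⟨hl.1, hl.2.trans ht.2⟩, this⟩
  have h2 : l = t := le_antisymm hl.2 h1
  rw [h2] at hl'
  linarith

lemma affine {V1 V2 W1 W2 : ℝ → ℝ} (c1 : Continuous V1) (c2 : Continuous V2)
    (m1 : StrictMono V1) (m2 : StrictMono V2) (cW : Continuous W1)
    (H : ∀ x x' y y', V1 x' - V1 x = V2 y' - V2 y → W1 x' - W1 x = W2 y' - W2 y) :
    ∀ x, W1 x = W1 0 + (W1 1 - W1 0) / (V1 1 - V1 0) * (V1 x - V1 0) := by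
  have key : ∀ a b, a < b → ∀ x ∈ Set.Icc a b,
      W1 x - W1 a = (W1 b - W1 a) / (V1 b - V1 a) * (V1 x - V1 a) := by
    intro a b hab x hx
    have hne : V1 b - V1 a ≠ 0 := by have := m1 hab; linarith
    set κ := (W1 b - W1 a) / (V1 b - V1 a) with hκ
    have hk : κ * (V1 b - V1 a) = W1 b - W1 a := div_mul_cancel₀ _ hne
    have u := rigid c1 c2 m1 m2 cW H hab κ (W1 a - κ * V1 a) (by ring) (by linarith) x hx
    have l := rigid (W1 := fun x => - W1 x) (W2 := fun x => - W2 x) c1 c2 m1 m2 cW.neg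
      (fun x x' y y' h => by have := H x x' y y' h; linarith) hab (-κ) (-(W1 a - κ * V1 a))
      (by ring) (by linarith) x hx
    linarith
  intro x
  set a := min x 0 with ha
  set b := max x 1 with hb
  have ha0 : a ≤ 0 := min_le_right _ _
  have hax : a ≤ x := min_le_left _ _
  have hb1 : 1 ≤ b := le_max_right _ _
  have hbx : x ≤ b := le_max_left _ _
  have hab : a < b := by linarith
  have k0 := key a b hab 0 ⟨ha0, by linarith⟩
  have k1 := key a b hab 1 ⟨by linarith, hb1⟩
  have kx := key a b hab x ⟨hax, hbx⟩
  have hne : V1 1 - V1 0 ≠ 0 := by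
    have := m1 (show (0:ℝ) < 1 by norm_num)
    linarith
  set κ := (W1 b - W1 a) / (V1 b - V1 a)
  have : (W1 1 - W1 0) / (V1 1 - V1 0) = κ := by
    rw [div_eq_iff hne]; linarith
  rw [this]; linarith

/-- Two-coordinate uniqueness. -/
lemma unique2 {V1 V2 W1 W2 : ℝ → ℝ} (c1 : Continuous V1) (c2 : Continuous V2)
    (m1 : StrictMono V1) (m2 : StrictMono V2)
    (H : ∀ x x' y y', V1 x' - V1 x ≤ V2 y' - V2 y ↔ W1 x' - W1 x ≤ W2 y' - W2 y) :
    ∃ σ, 0 < σ ∧ (∀ x, W1 x = W1 0 + σ * (V1 x - V1 0)) ∧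
      (∀ x, W2 x = W2 0 + σ * (V2 x - V2 0)) := by
  have n1 : StrictMono W1 := by
    intro x y hxy
    by_contra hcon
    have := (H x y 0 0).2 (by linarith)
    have := m1 hxy
    linarith
  have n2 : StrictMono W2 := by
    intro x y hxy
    by_contra hcon
    have := (H 0 0 y x).2 (by linarith)
    have := m2 hxy
    linarith
  have cW1 : Continuous W1 := by
    rw [continuous_iff_continuousAt]
    intro z
    rw [Metric.continuousAt_iff']
    intro ε hε
    obtain ⟨y, y', hy, hs⟩ := exists_small n2.monotone hε
    have h := (Metric.continuousAt_iff'.1 (c1.continuousAt (x := z))) (V2 y' - V2 y)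
      (by have := m2 hy; linarith)
    filter_upwards [h] with w hw
    rw [Real.dist_eq, abs_lt] at *
    have q1 := (H z w y y').1 (by linarith)
    have q2 := (H w z y y').1 (by linarith)
    constructor <;> linarith
  have cW2 : Continuous W2 := by
    rw [continuous_iff_continuousAt]
    intro z
    rw [Metric.continuousAt_iff']
    intro ε hε
    obtain ⟨y, y', hy, hs⟩ := exists_small n1.monotone hε
    have h := (Metric.continuousAt_iff'.1 (c2.continuousAt (x := z))) (V1 y' - V1 y)
      (by have := m1 hy; linarith)
    filter_upwards [h] with w hw
    rw [Real.dist_eq, abs_lt] at *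
    have q1 := (H y' y z w).1 (by linarith)
    have q2 := (H y' y w z).1 (by linarith)
    constructor <;> linarith
  have HE : ∀ x x' y y', V1 x' - V1 x = V2 y' - V2 y → W1 x' - W1 x = W2 y' - W2 y := by
    intro x x' y y' h
    have q1 := (H x x' y y').1 h.le
    have q2 := (H x' x y' y).1 (by linarith)
    linarith
  have A1 := affine c1 c2 m1 m2 cW1 HE
  have A2 := affine c2 c1 m2 m1 cW2 (fun x x' y y' h => (HE y y' x x' h.symm).symm)
  have hV1 := m1 (show (0:ℝ) < 1 by norm_num)
  have hW1 := n1 (show (0:ℝ) < 1 by norm_num)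
  have hV2 := m2 (show (0:ℝ) < 1 by norm_num)
  set σ1 := (W1 1 - W1 0) / (V1 1 - V1 0) with hσ
  set σ2 := (W2 1 - W2 0) / (V2 1 - V2 0)
  have hpos : 0 < σ1 := div_pos (by linarith) (by linarith)
  have heq : σ1 = σ2 := by
    obtain ⟨δ, hδ, d2, d3⟩ : ∃ δ > 0, δ ≤ V1 1 - V1 0 ∧ δ ≤ V2 1 - V2 0 :=
      ⟨min (V1 1 - V1 0) (V2 1 - V2 0), by simp only [gt_iff_lt, lt_min_iff]; constructor <;> linarith,
        min_le_left _ _, min_le_right _ _⟩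
    obtain ⟨x, hx, hx'⟩ := intermediate_value_Icc (show (0:ℝ) ≤ 1 by norm_num) c1.continuousOn
      (show V1 0 + δ ∈ Icc (V1 0) (V1 1) from ⟨by linarith, by linarith⟩)
    obtain ⟨y, hy, hy'⟩ := intermediate_value_Icc (show (0:ℝ) ≤ 1 by norm_num) c2.continuousOn
      (show V2 0 + δ ∈ Icc (V2 0) (V2 1) from ⟨by linarith, by linarith⟩)
    have q := HE 0 x 0 y (by linarith)
    have a1 := A1 x
    have a2 := A2 y
    rw [hx'] at a1
    rw [hy'] at a2
    have : σ1 * δ = σ2 * δ := by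
      have e1 : V1 0 + δ - V1 0 = δ := by ring
      have e2 : V2 0 + δ - V2 0 = δ := by ring
      rw [e1] at a1
      rw [e2] at a2
      linarith
    exact mul_right_cancel₀ hδ.ne' this
  exact ⟨σ1, hpos, A1, by rw [heq]; exact A2⟩

end DebreuAux

namespace DebreuAux

lemma paste_single {n : ℕ} (j : Fin n) (f g : Fin n → ℝ) :
    paste {j} f g = Function.update g j (f j) := by
  ext l
  by_cases h : l = j
  · subst h; simp [paste]
  · simp [paste, h]

lemma paste_pair {n : ℕ} {i j : Fin n} (hij : i ≠ j) (h h' : Fin n → ℝ) (x y : ℝ) :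
    paste {i, j} (U h' i x j y) h = U h i x j y := by
  ext l
  by_cases h1 : l = j
  · subst h1; simp [paste, U]
  · by_cases h2 : l = i
    · subst h2; simp [paste, U, hij]
    · simp [paste, U, h1, h2]

lemma sum_paste {n : ℕ} (V : Fin n → ℝ → ℝ) (A : Set (Fin n)) (f g : Fin n → ℝ) :
    ∑ j, V j (paste A f g j) = ∑ j, Set.indicator A (fun j => V j (f j)) j +
      ∑ j, Set.indicator Aᶜ (fun j => V j (g j)) j := by
  rw [← Finset.sum_add_distrib]
  refine Finset.sum_congr rfl fun j _ => ?_
  by_cases h : j ∈ A <;> simp [paste, h]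

lemma forward {n : ℕ} (R : (Fin n → ℝ) → (Fin n → ℝ) → Prop) (V : Fin n → ℝ → ℝ)
    (hc : ∀ j, Continuous (V j)) (hm : ∀ j, ¬ NullEvent R {j} → StrictMono (V j))
    (h0 : ∀ j, NullEvent R {j} → ∀ x y : ℝ, V j x = V j y)
    (hR : ∀ f g : Fin n → ℝ, R f g ↔ ∑ j, V j (g j) ≤ ∑ j, V j (f j)) :
    ((∀ f, R f f) ∧
       (∀ f g, R f g ∨ R g f) ∧
       (∀ f g h, R f g → R g h → R f h) ∧
       (∀ f : Fin n → ℝ, IsClosed {g | R g f} ∧ IsClosed {g | R f g}) ∧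
       (∀ (A : Set (Fin n)), ¬ NullEvent R A → ∀ (f : Fin n → ℝ) (x y : ℝ), y < x →
         (R (paste A (fun _ => x) f) (paste A (fun _ => y) f) ∧
          ¬ R (paste A (fun _ => y) f) (paste A (fun _ => x) f))) ∧
       (∀ (f g h : Fin n → ℝ) (A : Set (Fin n)), R (paste A g h) (paste A f h) →
         ∀ c : Fin n → ℝ, R (paste A g c) (paste A f c))) := by
  have cs : Continuous fun g : Fin n → ℝ => ∑ j, V j (g j) :=
    continuous_finsetSum _ fun j _ => (hc j).comp (continuous_apply j)
  refine ⟨fun f => (hR _ _).2 le_rfl, fun f g => ?_, fun f g h h1 h2 => ?_, fun f => ⟨?_, ?_⟩, ?_, ?_⟩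
  · rw [hR, hR]; exact le_total _ _
  · rw [hR] at *; exact h2.trans h1
  · simp only [hR]; exact isClosed_le continuous_const cs
  · simp only [hR]; exact isClosed_le cs continuous_const
  · intro A hA f x y hxy
    obtain ⟨j, hjA, hj⟩ : ∃ j ∈ A, ¬ NullEvent R {j} := by
      by_contra hcon
      push Not at hcon
      refine hA fun f g => ?_
      have : ∑ j, V j (paste A f g j) = ∑ j, V j (g j) := by
        refine Finset.sum_congr rfl fun j _ => ?_
        by_cases h : j ∈ A
        · exact h0 j (hcon j h) _ _
        · simp [paste, h]
      rw [hR, hR, this]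
      exact ⟨le_rfl, le_rfl⟩
    have mono : ∀ j, Monotone (V j) := by
      intro j
      by_cases h : NullEvent R {j}
      · intro x y _; exact (h0 j h x y).le
      · exact (hm j h).monotone
    have : ∑ j, V j (paste A (fun _ => y) f j) < ∑ j, V j (paste A (fun _ => x) f j) := by
      refine Finset.sum_lt_sum (fun l _ => mono l ?_) ⟨j, Finset.mem_univ _, hm j hj ?_⟩
      · by_cases h : l ∈ A
        · simp [paste, h, hxy.le]
        · simp [paste, h]
      · simpa [paste, hjA] using hxy
    rw [hR, hR]
    exact ⟨this.le, not_le.2 this⟩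
  · intro f g h A H c
    rw [hR, sum_paste, sum_paste] at *
    linarith

lemma backward {n : ℕ} (R : (Fin n → ℝ) → (Fin n → ℝ) → Prop)
    (hthree : ∃ j₁ j₂ j₃ : Fin n, j₁ ≠ j₂ ∧ j₁ ≠ j₃ ∧ j₂ ≠ j₃ ∧
      ¬ NullEvent R {j₁} ∧ ¬ NullEvent R {j₂} ∧ ¬ NullEvent R {j₃})
    (hrefl : ∀ f, R f f) (htot : ∀ f g, R f g ∨ R g f) (htr : ∀ f g h, R f g → R g h → R f h)
    (hcl : ∀ f : Fin n → ℝ, IsClosed {g | R g f} ∧ IsClosed {g | R f g})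
    (hmo : ∀ (A : Set (Fin n)), ¬ NullEvent R A → ∀ (f : Fin n → ℝ) (x y : ℝ), y < x →
         (R (paste A (fun _ => x) f) (paste A (fun _ => y) f) ∧
          ¬ R (paste A (fun _ => y) f) (paste A (fun _ => x) f)))
    (hst : ∀ (f g h : Fin n → ℝ) (A : Set (Fin n)), R (paste A g h) (paste A f h) →
         ∀ c : Fin n → ℝ, R (paste A g c) (paste A f c)) :
    ∃ V : Fin n → ℝ → ℝ,
        (∀ j, Continuous (V j)) ∧
        (∀ j, ¬ NullEvent R {j} → StrictMono (V j)) ∧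
        (∀ j, NullEvent R {j} → ∀ x y : ℝ, V j x = V j y) ∧
        (∀ f g : Fin n → ℝ, R f g ↔ ∑ j, V j (g j) ≤ ∑ j, V j (f j)) := by
  classical
  obtain ⟨j1, j2, j3, h12, h13, h23, n1, n2, n3⟩ := hthree
  let p : Fin n → Prop := fun j => ¬ NullEvent R {j}
  let ext : ({j // p j} → ℝ) → Fin n → ℝ := fun a j => if h : p j then a ⟨j, h⟩ else 0
  have ext_upd : ∀ a i x, ext (Function.update a i x) = Function.update (ext a) i.1 x := by
    rintro a ⟨i, hi⟩ x
    funext j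
    by_cases hj : j = i
    · subst hj; simp [ext, hi]
    · by_cases h : p j
      · simp [ext, h, hj]
      · simp [ext, h, hj]
  have ext_cont : Continuous ext := by
    refine continuous_pi fun j => ?_
    by_cases h : p j
    · simp only [ext, h, dite_true]; exact continuous_apply _
    · simp only [ext, h, dite_false]; exact continuous_const
  have ninv : ∀ f g : Fin n → ℝ, (∀ j, p j → f j = g j) → R f g ∧ R g f := by
    intro f g hfg
    have key : ∀ s : Finset (Fin n), R f (fun j => if j ∈ s then g j else f j) ∧
        R (fun j => if j ∈ s then g j else f j) f := by
      intro s
      induction s using Finset.induction_on with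
      | empty => simpa using hrefl f
      | insert a s ha ih =>
        have hu : (fun j => if j ∈ insert a s then g j else f j) =
            Function.update (fun j => if j ∈ s then g j else f j) a (g a) := by
          ext j
          by_cases hj : j = a
          · subst hj; simp
          · simp [hj]
        rw [hu]
        by_cases hp : p a
        · have : Function.update (fun j => if j ∈ s then g j else f j) a (g a) =
              (fun j => if j ∈ s then g j else f j) := by
            rw [Function.update_eq_self_iff]; simp [ha, hfg a hp]
          rw [this]; exact ih
        · have hn : NullEvent R {a} := not_not.1 hp
          have := hn g (fun j => if j ∈ s then g j else f j)
          rw [paste_single] at this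
          exact ⟨htr _ _ _ ih.1 this.2, htr _ _ _ this.1 ih.2⟩
    simpa using key Finset.univ
  have P : Pref (fun a b : {j // p j} → ℝ => R (ext b) (ext a)) := by
    refine ⟨fun f g => htot _ _, fun h1 h2 => htr _ _ _ h2 h1, fun f => ?_, fun f => ?_, ?_, ?_⟩
    · exact (hcl (ext f)).2.preimage ext_cont
    · exact (hcl (ext f)).1.preimage ext_cont
    · intro f j x y hxy
      have := (hmo {j.1} j.2 (ext f) y x hxy).2
      rw [paste_single, paste_single] at this
      rw [ext_upd, ext_upd]
      exact this
    · intro i j hij h h' x y x' y' H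
      have hij' : i.1 ≠ j.1 := fun h => hij (Subtype.ext h)
      simp only [ext_upd] at *
      have := hst (U 0 i.1 x j.1 y) (U 0 i.1 x' j.1 y') (ext h) {i.1, j.1}
        (by rw [paste_pair hij', paste_pair hij']; exact H) (ext h')
      rw [paste_pair hij', paste_pair hij'] at this
      exact this
  obtain ⟨V, V1, V2, V3⟩ := P.rep (i1 := ⟨j1, n1⟩) (i2 := ⟨j2, n2⟩) (i3 := ⟨j3, n3⟩)
    (fun h => h12 (congrArg Subtype.val h)) (fun h => h13 (congrArg Subtype.val h))
    (fun h => h23 (congrArg Subtype.val h))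
  refine ⟨fun j x => if h : p j then V ⟨j, h⟩ x else 0, ?_, ?_, ?_, ?_⟩
  · intro j
    by_cases h : p j
    · simp only [h, dite_true]; exact V1 _
    · simp only [h, dite_false]; exact continuous_const
  · intro j h
    have h : p j := h
    simp only [h, dite_true]; exact V2 _
  · intro j h x y
    have h : ¬ p j := not_not.2 h
    simp only [h, dite_false]
  · intro f g
    have hs : ∀ f : Fin n → ℝ, ∑ j, (if h : p j then V ⟨j, h⟩ (f j) else 0) =
        ∑ i : {j // p j}, V i (f i.1) := by
      intro f
      rw [← Finset.sum_filter_of_ne (p := p) (by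
        intro j _ h
        by_contra hp
        exact h (dif_neg (not_not.2 hp)))]
      rw [Finset.sum_subtype (p := p) _ (by simp)]
      refine Finset.sum_congr rfl fun i _ => ?_
      simp [i.2]
    have hres : ∀ f : Fin n → ℝ, R f (ext fun i => f i.1) ∧ R (ext fun i => f i.1) f := by
      intro f
      refine ninv _ _ fun j hj => ?_
      simp [ext, hj]
    rw [hs, hs]
    rw [← V3 (fun i => g i.1) (fun i => f i.1)]
    exact ⟨fun h => htr _ _ _ (hres f).2 (htr _ _ _ h (hres g).1),
      fun h => htr _ _ _ (hres f).1 (htr _ _ _ h (hres g).2)⟩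

lemma uniq {n : ℕ} (R : (Fin n → ℝ) → (Fin n → ℝ) → Prop)
    (hthree : ∃ j₁ j₂ j₃ : Fin n, j₁ ≠ j₂ ∧ j₁ ≠ j₃ ∧ j₂ ≠ j₃ ∧
      ¬ NullEvent R {j₁} ∧ ¬ NullEvent R {j₂} ∧ ¬ NullEvent R {j₃})
    (V : Fin n → ℝ → ℝ)
    (hc : ∀ j, Continuous (V j)) (hm : ∀ j, ¬ NullEvent R {j} → StrictMono (V j))
    (h0 : ∀ j, NullEvent R {j} → ∀ x y : ℝ, V j x = V j y)
    (hR : ∀ f g : Fin n → ℝ, R f g ↔ ∑ j, V j (g j) ≤ ∑ j, V j (f j))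
    (W : Fin n → ℝ → ℝ) :
    ((∀ f g : Fin n → ℝ, R f g ↔ ∑ j, W j (g j) ≤ ∑ j, W j (f j)) ↔
          ∃ (τ : Fin n → ℝ) (σ : ℝ), 0 < σ ∧
            ∀ j x, W j x = τ j + σ * V j x) := by
  constructor
  · intro hW
    obtain ⟨j1, j2, j3, h12, h13, h23, n1, n2, n3⟩ := hthree
    have pair : ∀ j, j1 ≠ j → ¬ NullEvent R {j} → ∃ σ, 0 < σ ∧
        (∀ x, W j1 x = W j1 0 + σ * (V j1 x - V j1 0)) ∧
        (∀ x, W j x = W j 0 + σ * (V j x - V j 0)) := by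
      intro j hj hn
      refine unique2 (hc j1) (hc j) (hm j1 n1) (hm j hn) fun x x' y y' => ?_
      have a := hR (U 0 j1 x j y') (U 0 j1 x' j y)
      have b := hW (U 0 j1 x j y') (U 0 j1 x' j y)
      rw [sum_U _ _ hj, sum_U _ _ hj] at a b
      have c := a.symm.trans b
      constructor
      · intro h; have := c.1 (by linarith); linarith
      · intro h; have := c.2 (by linarith); linarith
    obtain ⟨σ, hσ, hs1, hs2⟩ := pair j2 h12 n2
    refine ⟨fun j => W j 0 - σ * V j 0, σ, hσ, fun j x => ?_⟩
    have hlt := hm j1 n1 (show (0:ℝ) < 1 by norm_num)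
    by_cases hn : NullEvent R {j}
    · have hq := hn (fun _ => x) 0
      rw [hW, hW, paste_single] at hq
      have he := le_antisymm hq.2 hq.1
      have e1 : ∀ F : Fin n → ℝ → ℝ, ∑ l, F l (Function.update (0 : Fin n → ℝ) j x l) =
          F j x + ∑ l ∈ univ.erase j, F l 0 := by
        intro F
        rw [← Finset.add_sum_erase _ _ (Finset.mem_univ j)]
        congr 1
        · simp
        · refine Finset.sum_congr rfl fun l hl => ?_
          simp [(Finset.mem_erase.1 hl).1]
      rw [e1, ← Finset.add_sum_erase _ (fun l => W l ((0 : Fin n → ℝ) l)) (Finset.mem_univ j)] at he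
      simp only [Pi.zero_apply] at he
      rw [h0 j hn x 0]
      linarith
    · by_cases hj : j1 = j
      · subst hj; rw [hs1 x]; ring
      · obtain ⟨σ', _, hs1', hs2'⟩ := pair j hj hn
        have : σ' = σ := by
          have a := hs1 1
          have b := hs1' 1
          refine mul_right_cancel₀ (b := V j1 1 - V j1 0) (by linarith) ?_
          linarith
        rw [hs2' x, this]; ring
  · rintro ⟨τ, σ, hσ, h⟩ f g
    have : ∀ f : Fin n → ℝ, ∑ j, W j (f j) = ∑ j, τ j + σ * ∑ j, V j (f j) := by
      intro f
      rw [Finset.mul_sum, ← Finset.sum_add_distrib]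
      exact Finset.sum_congr rfl fun j _ => h j _
    rw [hR, this, this, add_le_add_iff_left, mul_le_mul_iff_right₀ hσ]

end DebreuAux

/-- **Debreu's state-dependent expected utility theorem (finite state space)**: for a binary
relation `⪰` on acts `Fin n → ℝ` with at least three non-null states, an additively
separable continuous representation (strictly increasing at non-null states, constant at
null states) exists iff `⪰` is a complete transitive preference order which is norm
continuous, strictly monotone and satisfies the sure-thing principle; and the
representation is unique up to positive affine transformations. -/
theorem debreu_state_dependent_utility
    {n : ℕ} (R : (Fin n → ℝ) → (Fin n → ℝ) → Prop)
    -- at least three non-null states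
    (hthree : ∃ j₁ j₂ j₃ : Fin n, j₁ ≠ j₂ ∧ j₁ ≠ j₃ ∧ j₂ ≠ j₃ ∧
      ¬ NullEvent R {j₁} ∧ ¬ NullEvent R {j₂} ∧ ¬ NullEvent R {j₃}) :
    ((∃ V : Fin n → ℝ → ℝ,
        (∀ j, Continuous (V j)) ∧
        (∀ j, ¬ NullEvent R {j} → StrictMono (V j)) ∧
        (∀ j, NullEvent R {j} → ∀ x y : ℝ, V j x = V j y) ∧
        (∀ f g : Fin n → ℝ, R f g ↔ ∑ j, V j (g j) ≤ ∑ j, V j (f j)))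
      ↔
      ((∀ f, R f f) ∧
       (∀ f g, R f g ∨ R g f) ∧
       (∀ f g h, R f g → R g h → R f h) ∧
       -- norm continuity
       (∀ f : Fin n → ℝ, IsClosed {g | R g f} ∧ IsClosed {g | R f g}) ∧
       -- strict monotonicity
       (∀ (A : Set (Fin n)), ¬ NullEvent R A → ∀ (f : Fin n → ℝ) (x y : ℝ), y < x →
         (R (paste A (fun _ => x) f) (paste A (fun _ => y) f) ∧
          ¬ R (paste A (fun _ => y) f) (paste A (fun _ => x) f))) ∧
       -- sure-thing principle
       (∀ (f g h : Fin n → ℝ) (A : Set (Fin n)), R (paste A g h) (paste A f h) →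
         ∀ c : Fin n → ℝ, R (paste A g c) (paste A f c)))) ∧
    -- uniqueness
    (∀ V : Fin n → ℝ → ℝ,
      (∀ j, Continuous (V j)) →
      (∀ j, ¬ NullEvent R {j} → StrictMono (V j)) →
      (∀ j, NullEvent R {j} → ∀ x y : ℝ, V j x = V j y) →
      (∀ f g : Fin n → ℝ, R f g ↔ ∑ j, V j (g j) ≤ ∑ j, V j (f j)) →
      ∀ W : Fin n → ℝ → ℝ,
        ((∀ f g : Fin n → ℝ, R f g ↔ ∑ j, W j (g j) ≤ ∑ j, W j (f j)) ↔
          ∃ (τ : Fin n → ℝ) (σ : ℝ), 0 < σ ∧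
            ∀ j x, W j x = τ j + σ * V j x)) := by
  refine ⟨⟨?_, ?_⟩, ?_⟩
  · rintro ⟨V, h1, h2, h3, h4⟩
    exact DebreuAux.forward R V h1 h2 h3 h4
  · rintro ⟨h1, h2, h3, h4, h5, h6⟩
    exact DebreuAux.backward R hthree h1 h2 h3 h4 h5 h6
  · intro V h1 h2 h3 h4 W
    exact DebreuAux.uniq R hthree V h1 h2 h3 h4 W
end

section
/- Pointwise continuity of the integral representation: let P₁ be a probability measure on (Ω,F₁) and u₁ : ℝ×Ω → ℝ a random field such that u₁(·,ω) is nondecreasing for every ω, ω ↦ u₁(f(ω),ω) is F₁-measurable for every bounded F₁-measurable f, ω ↦ u₁(c,ω) is P₁-integrable for every constant c ∈ ℝ, and u₁ is ★-continuous with respect to P₁. Then for every uniformly bounded sequence (f_n) of F₁-measurable functions converging pointwise to f, ∫_Ω u₁(f_n(ω),ω) dP₁(ω) → ∫_Ω u₁(f(ω),ω) dP₁(ω). -/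
open MeasureTheory Set

/-- **Pointwise continuity of the integral representation**: if `u₁(·,ω)` is nondecreasing,
`ω ↦ u₁ (f ω) ω` is measurable for every bounded measurable `f`, `ω ↦ u₁ (c, ω)` is
integrable for every constant `c`, and `u₁` is `★`-continuous with respect to the
probability `P₁`, then for every uniformly bounded sequence `(f_n)` of measurable functions
converging pointwise to `f`, `∫ u₁ (f_n ω) ω dP₁ → ∫ u₁ (f ω) ω dP₁`. -/
theorem integral_pointwise_continuous
    {Ω : Type*} (F₁ : MeasurableSpace Ω)
    (P₁ : @MeasureTheory.Measure Ω F₁) (hP₁ : IsProbabilityMeasure P₁)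
    (u₁ : ℝ → Ω → ℝ)
    (hmono : ∀ ω, Monotone (fun x => u₁ x ω))
    (hmeas : ∀ f : Ω → ℝ, BddMeas F₁ f → Measurable[F₁] (fun ω => u₁ (f ω) ω))
    (hint : ∀ c : ℝ, Integrable (fun ω => u₁ c ω) P₁)
    (hstar : StarCont F₁ P₁ u₁)
    (fn : ℕ → Ω → ℝ) (f : Ω → ℝ)
    (hfn : ∀ n, Measurable[F₁] (fn n)) (hf : BddMeas F₁ f)
    (hbdd : ∃ C, ∀ n ω, |fn n ω| ≤ C)
    (hconv : ∀ ω, Filter.Tendsto (fun n => fn n ω) Filter.atTop (nhds (f ω))) :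
    Filter.Tendsto (fun n => ∫ ω, u₁ (fn n ω) ω ∂P₁) Filter.atTop
      (nhds (∫ ω, u₁ (f ω) ω ∂P₁)) := by
  obtain ⟨C, hC⟩ := hbdd
  refine tendsto_integral_of_dominated_convergence
    (fun ω => |u₁ (-C) ω| + |u₁ C ω|) ?_ ?_ ?_ ?_
  · intro n
    exact (hmeas (fn n) ⟨hfn n, C, hC n⟩).aestronglyMeasurable
  · exact (hint (-C)).abs.add (hint C).abs
  · intro n
    refine Filter.Eventually.of_forall fun ω => ?_
    obtain ⟨h1, h2⟩ := abs_le.mp (hC n ω)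
    have h3 : u₁ (-C) ω ≤ u₁ (fn n ω) ω := hmono ω h1
    have h4 : u₁ (fn n ω) ω ≤ u₁ C ω := hmono ω h2
    rw [Real.norm_eq_abs, abs_le]
    constructor
    · linarith [neg_abs_le (u₁ (-C) ω), abs_nonneg (u₁ C ω)]
    · linarith [le_abs_self (u₁ C ω), abs_nonneg (u₁ (-C) ω)]
  · have h : ∀ᵐ ω ∂P₁, ContinuousAt (fun x => u₁ x ω) (f ω) := ae_iff.mpr (hstar f hf)
    filter_upwards [h] with ω hω
    exact hω.tendsto.comp (hconv ω)
end

section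
/- ★-continuity from Axiom (C.0): let P₁ be a probability on (Ω,F₁), u₁ : ℝ×Ω → ℝ with u₁(·,ω) strictly increasing for every ω, ω ↦ u₁(f(ω),ω) F₁-measurable and P₁-integrable for every f ∈ 𝓛∞(F₁), and suppose V₁(f) = ∫ u₁(f(ω),ω) dP₁ takes values in the range of u₀ and represents the preference (a ⪯ f ⟺ u₀(a) ≤ V₁(f), a ⪰ f ⟺ u₀(a) ≥ V₁(f)). If the preference satisfies Axiom (C.0), then u₁ is ★-continuous with respect to P₁: for every f ∈ 𝓛∞(F₁), the set D_f = {ω : u₁(·,ω) is discontinuous at f(ω)} has P₁(D_f) = 0. -/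
open MeasureTheory Set

theorem star_aux {Ω : Type*} [MeasurableSpace Ω] (P : Measure Ω) [IsProbabilityMeasure P]
    (u : ℝ → Ω → ℝ) (hmono : ∀ ω, StrictMono (fun x => u x ω))
    (hint : ∀ f : Ω → ℝ, BddMeas ‹_› f → Integrable (fun ω => u (f ω) ω) P)
    (hV : ∀ (fn : ℕ → Ω → ℝ) (f : Ω → ℝ), (∀ n, BddMeas ‹_› (fn n)) → BddMeas ‹_› f →
      (∃ C, ∀ n ω, |fn n ω| ≤ C) →
      (∀ ω, Filter.Tendsto (fun n => fn n ω) Filter.atTop (nhds (f ω))) →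
      Filter.Tendsto (fun n => ∫ ω, u (fn n ω) ω ∂P) Filter.atTop
        (nhds (∫ ω, u (f ω) ω ∂P)))
    (f : Ω → ℝ) (hf : BddMeas ‹_› f) :
    P {ω | ¬ ContinuousAt (fun x => u x ω) (f ω)} = 0 := by
  obtain ⟨hfm, C, hC⟩ := hf
  have ht := tendsto_one_div_add_atTop_nhds_zero_nat (𝕜 := ℝ)
  have hpos : ∀ n : ℕ, (0 : ℝ) < 1 / ((n : ℝ) + 1) := fun n => by positivity
  have hle1 : ∀ n : ℕ, 1 / ((n : ℝ) + 1) ≤ 1 := fun n => by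
    rw [div_le_one (by positivity)]
    have : (0 : ℝ) ≤ n := Nat.cast_nonneg n
    linarith
  have hbg : ∀ (n : ℕ) ω, |f ω + 1 / ((n : ℝ) + 1)| ≤ C + 1 := fun n ω => by
    have := abs_le.1 (hC ω)
    rw [abs_le]
    constructor <;> linarith [hpos n, hle1 n]
  have hbh : ∀ (n : ℕ) ω, |f ω - 1 / ((n : ℝ) + 1)| ≤ C + 1 := fun n ω => by
    have := abs_le.1 (hC ω)
    rw [abs_le]
    constructor <;> linarith [hpos n, hle1 n]
  have hg : ∀ n : ℕ, BddMeas ‹_› (fun ω => f ω + 1 / ((n : ℝ) + 1)) :=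
    fun n => ⟨hfm.add_const _, C + 1, hbg n⟩
  have hh : ∀ n : ℕ, BddMeas ‹_› (fun ω => f ω - 1 / ((n : ℝ) + 1)) :=
    fun n => ⟨hfm.sub_const _, C + 1, hbh n⟩
  have h1 := hV _ f hg ⟨hfm, C, hC⟩ ⟨C + 1, hbg⟩
    (fun ω => by simpa using ht.const_add (f ω))
  have h2 := hV _ f hh ⟨hfm, C, hC⟩ ⟨C + 1, hbh⟩
    (fun ω => by simpa using ht.const_sub (f ω))
  have h3 := h1.sub h2
  rw [sub_self] at h3
  let d : ℕ → Ω → ℝ := fun n ω =>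
    u (f ω + 1 / ((n : ℝ) + 1)) ω - u (f ω - 1 / ((n : ℝ) + 1)) ω
  have hdint : ∀ n, Integrable (d n) P := fun n => (hint _ (hg n)).sub (hint _ (hh n))
  have hd0 : ∀ n, 0 ≤ d n := fun n ω => by
    have := hmono ω (show f ω - 1 / ((n : ℝ) + 1) < f ω + 1 / ((n : ℝ) + 1) by linarith [hpos n])
    exact sub_nonneg.2 this.le
  have h4 : Filter.Tendsto (fun n => ∫ ω, d n ω ∂P) Filter.atTop (nhds 0) := by
    refine h3.congr fun n => ?_
    exact (integral_sub (hint _ (hg n)) (hint _ (hh n))).symm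
  have hk : ∀ k : ℕ, P {ω | ∀ n, 1 / ((k : ℝ) + 1) ≤ d n ω} = 0 := by
    intro k
    rw [← measureReal_eq_zero_iff]
    have hb : ∀ n, 1 / ((k : ℝ) + 1) * P.real {ω | ∀ n, 1 / ((k : ℝ) + 1) ≤ d n ω}
        ≤ ∫ ω, d n ω ∂P := fun n => by
      refine le_trans ?_ (mul_meas_ge_le_integral_of_nonneg
        (Filter.Eventually.of_forall (hd0 n)) (hdint n) (1 / ((k : ℝ) + 1)))
      refine mul_le_mul_of_nonneg_left ?_ (hpos k).le
      exact measureReal_mono (fun ω hω => hω n)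
    have h5 := ge_of_tendsto' h4 hb
    have h6 : 0 ≤ P.real {ω | ∀ n, 1 / ((k : ℝ) + 1) ≤ d n ω} := measureReal_nonneg
    have := hpos k
    by_contra hne
    have : 0 < P.real {ω | ∀ n, 1 / ((k : ℝ) + 1) ≤ d n ω} := lt_of_le_of_ne h6 (Ne.symm hne)
    have := mul_pos (hpos k) this
    linarith
  refine measure_mono_null ?_ (measure_iUnion_null hk)
  intro ω hω
  by_contra hcon
  apply hω
  simp only [mem_iUnion, mem_setOf_eq, not_exists, not_forall, not_le] at hcon
  rw [Metric.continuousAt_iff]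
  intro ε hε
  obtain ⟨k, hkε⟩ := exists_nat_one_div_lt hε
  obtain ⟨n, hn⟩ := hcon k
  refine ⟨1 / ((n : ℝ) + 1), hpos n, fun {x} hx => ?_⟩
  rw [Real.dist_eq, abs_lt] at hx
  have m := (hmono ω).monotone
  have a1 : u x ω ≤ u (f ω + 1 / ((n : ℝ) + 1)) ω := m (by linarith [hx.2])
  have a2 : u (f ω - 1 / ((n : ℝ) + 1)) ω ≤ u x ω := m (by linarith [hx.1])
  have a3 : u (f ω) ω ≤ u (f ω + 1 / ((n : ℝ) + 1)) ω := m (by linarith [hpos n])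
  have a4 : u (f ω - 1 / ((n : ℝ) + 1)) ω ≤ u (f ω) ω := m (by linarith [hpos n])
  have hn' : u (f ω + 1 / ((n : ℝ) + 1)) ω - u (f ω - 1 / ((n : ℝ) + 1)) ω
    < 1 / ((k : ℝ) + 1) := hn
  rw [Real.dist_eq, abs_lt]
  constructor <;> linarith

/-- **`★`-continuity from Axiom (C.0)**: if the integral functional
`V₁ f = ∫ u₁ (f ω) ω dP₁` takes values in the range of `u₀` and represents the preference
`(⪰,⪯)`, and the preference satisfies the pointwise-continuity Axiom (C.0), then `u₁` is
`★`-continuous with respect to `P₁`: for every bounded `F₁`-measurable `f`, the set of `ω`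
at which `u₁(·,ω)` is discontinuous at `f ω` is `P₁`-null. -/
theorem star_continuity_from_C0
    {Ω : Type*} [F : MeasurableSpace Ω] (F₁ : MeasurableSpace Ω) (hF₁ : F₁ ≤ F)
    (u₀ : ℝ → ℝ) (hu₀mono : StrictMono u₀) (hu₀cont : Continuous u₀) (hu₀zero : u₀ 0 = 0)
    (succ prec : ℝ → (Ω → ℝ) → Prop)
    (P₁ : @MeasureTheory.Measure Ω F₁) (hP₁ : IsProbabilityMeasure P₁)
    (u₁ : ℝ → Ω → ℝ)
    (hu₁mono : ∀ ω, StrictMono (fun x => u₁ x ω))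
    (hu₁meas : ∀ f : Ω → ℝ, BddMeas F₁ f →
      Measurable[F₁] (fun ω => u₁ (f ω) ω) ∧ Integrable (fun ω => u₁ (f ω) ω) P₁)
    -- V₁ takes values in the range of u₀
    (hrange : ∀ f : Ω → ℝ, BddMeas F₁ f → (∫ ω, u₁ (f ω) ω ∂P₁) ∈ Set.range u₀)
    -- V₁ represents the preference
    (hrepr : ∀ (a : ℝ) (f : Ω → ℝ), BddMeas F₁ f →
      (prec a f ↔ u₀ a ≤ ∫ ω, u₁ (f ω) ω ∂P₁) ∧
      (succ a f ↔ (∫ ω, u₁ (f ω) ω ∂P₁) ≤ u₀ a))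
    -- Axiom (C.0)
    (hC0 : ∀ (fn : ℕ → Ω → ℝ) (f : Ω → ℝ), (∀ n, BddMeas F₁ (fn n)) → BddMeas F₁ f →
      (∃ C, ∀ n ω, |fn n ω| ≤ C) →
      (∀ ω, Filter.Tendsto (fun n => fn n ω) Filter.atTop (nhds (f ω))) →
      ∀ a : ℝ,
        ((prec a f ∧ ¬ succ a f) → ∃ N, ∀ n > N, prec a (fn n)) ∧
        ((succ a f ∧ ¬ prec a f) → ∃ N, ∀ n > N, succ a (fn n))) :
    ∀ f : Ω → ℝ, BddMeas F₁ f →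
      P₁ {ω | ¬ ContinuousAt (fun x => u₁ x ω) (f ω)} = 0 := by
  refine star_aux P₁ u₁ hu₁mono (fun f hf => (hu₁meas f hf).2) ?_
  intro fn f hfn hf hb ht
  obtain ⟨b, hb'⟩ := hrange f hf
  have hC := hC0 fn f hfn hf hb ht
  rw [tendsto_order]
  constructor
  · intro v hv
    rw [← hb'] at hv
    obtain ⟨a, hva, hab⟩ := (((hu₀cont.tendsto b).eventually (lt_mem_nhds hv)).filter_mono
      nhdsWithin_le_nhds |>.and (self_mem_nhdsWithin (s := Iio b))).exists
    have hlt := hu₀mono hab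
    obtain ⟨N, hN⟩ := (hC a).1 ⟨(hrepr a f hf).1.2 (hb' ▸ hlt.le),
      fun h => absurd ((hrepr a f hf).2.1 h) (not_le.2 (hb' ▸ hlt))⟩
    filter_upwards [Filter.eventually_gt_atTop N] with n hn
    exact lt_of_lt_of_le hva ((hrepr a _ (hfn n)).1.1 (hN n hn))
  · intro v hv
    rw [← hb'] at hv
    obtain ⟨a, hva, hab⟩ := (((hu₀cont.tendsto b).eventually (gt_mem_nhds hv)).filter_mono
      nhdsWithin_le_nhds |>.and (self_mem_nhdsWithin (s := Ioi b))).exists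
    have hlt := hu₀mono hab
    obtain ⟨N, hN⟩ := (hC a).2 ⟨(hrepr a f hf).2.2 (hb' ▸ hlt.le),
      fun h => absurd ((hrepr a f hf).1.1 h) (not_le.2 (hb' ▸ hlt))⟩
    filter_upwards [Filter.eventually_gt_atTop N] with n hn
    exact lt_of_le_of_lt ((hrepr a _ (hfn n)).2.1 (hN n hn)) hva
end
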